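/- arXiv:math-ph/0109027 — 2 statements merged into one kernel-verified Lean document; each statement's English description precedes it below -/
import Mathlib

section
/- As N → ∞, the logarithm of the number of partitions of N is asymptotically π·(2/3)^{1/2}·N^{1/2}; that is, log|𝒴_N| / N^{1/2} → π·√(2/3). -/
/-- Number of partitions of `n`. -/
def pcard (n : ℕ) : ℕ := Fintype.card (Nat.Partition n)

lemma pcard_pos (n : ℕ) : 1 ≤ pcard n := Fintype.card_pos

/-- Partitions of `n` with at least `k` copies of `v` are in bijection with those of `n - k v`. -/
lemma card_filter_count (n k v : ℕ) (hv : 1 ≤ v) (h : k * v ≤ n) :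
    (Finset.univ.filter (fun p : Nat.Partition n => k ≤ p.parts.count v)).card
      = pcard (n - k * v) := by
  unfold pcard
  rw [← Finset.card_univ]
  symm
  refine Finset.card_bij
    (fun q _ => (⟨q.parts + Multiset.replicate k v, ?_, ?_⟩ : Nat.Partition n)) ?_ ?_ ?_
  · intro i hi
    rcases Multiset.mem_add.1 hi with hi | hi
    · exact q.parts_pos hi
    · rw [Multiset.eq_of_mem_replicate hi]; omega
  · rw [Multiset.sum_add, q.parts_sum, Multiset.sum_replicate, smul_eq_mul]; omega
  · intro q _
    simp
  · intro q _ q' _ hq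
    have := congrArg Nat.Partition.parts hq
    simp only [add_left_inj] at this
    exact Nat.Partition.ext this
  · intro p hp
    have hp' : k ≤ p.parts.count v := (Finset.mem_filter.1 hp).2
    have hle : Multiset.replicate k v ≤ p.parts := Multiset.le_count_iff_replicate_le.1 hp'
    have hadd := Multiset.sub_add_cancel hle
    refine ⟨⟨p.parts - Multiset.replicate k v, ?_, ?_⟩, Finset.mem_univ _, ?_⟩
    · intro i hi
      exact p.parts_pos (Multiset.mem_of_le (Multiset.sub_le_self _ _) hi)
    · have := congrArg Multiset.sum hadd
      rw [Multiset.sum_add, p.parts_sum, Multiset.sum_replicate, smul_eq_mul] at this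
      omega
    · exact Nat.Partition.ext hadd

lemma sum_parts_eq (n : ℕ) (p : Nat.Partition n) :
    n = ∑ v ∈ Finset.Icc 1 n, ∑ k ∈ Finset.Icc 1 n,
      if k ≤ p.parts.count v then v else 0 := by
  have hle : ∀ a ∈ p.parts, a ≤ n := fun a ha => by
    have := Multiset.le_sum_of_mem ha
    rwa [p.parts_sum] at this
  have h1 : p.parts.sum = ∑ v ∈ Finset.Icc 1 n, p.parts.count v • v := by
    apply Finset.sum_multiset_count_of_subset
    intro a ha
    have ha := Multiset.mem_toFinset.1 ha
    exact Finset.mem_Icc.2 ⟨p.parts_pos ha, hle a ha⟩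
  rw [p.parts_sum] at h1
  conv_lhs => rw [h1]
  refine Finset.sum_congr rfl fun v hv => ?_
  have hv1 := (Finset.mem_Icc.1 hv).1
  have hc : p.parts.count v ≤ n := by
    have h2 : p.parts.count v • v ≤ n := by
      conv_rhs => rw [h1]
      exact Finset.single_le_sum (f := fun v => p.parts.count v • v)
        (fun _ _ => Nat.zero_le _) hv
    rw [smul_eq_mul] at h2
    nlinarith
  rw [← Finset.sum_filter, Finset.sum_const]
  congr 1
  have : (Finset.Icc 1 n).filter (fun k => k ≤ p.parts.count v)
      = Finset.Icc 1 (p.parts.count v) := by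
    ext k; simp only [Finset.mem_filter, Finset.mem_Icc]; omega
  rw [this]; simp

lemma pcard_rec (n : ℕ) :
    n * pcard n = ∑ k ∈ Finset.Icc 1 n, ∑ v ∈ Finset.Icc 1 n,
      if k * v ≤ n then v * pcard (n - k * v) else 0 := by
  have h : n * pcard n = ∑ p : Nat.Partition n, n := by
    simp [pcard, mul_comm]
  rw [h, Finset.sum_congr rfl (fun p _ => sum_parts_eq n p), Finset.sum_comm]
  conv_rhs => rw [Finset.sum_comm]
  refine Finset.sum_congr rfl fun v hv => ?_
  rw [Finset.sum_comm]
  refine Finset.sum_congr rfl fun k hk => ?_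
  rw [← Finset.sum_filter, Finset.sum_const, smul_eq_mul]
  split_ifs with hkv
  · rw [card_filter_count n k v (Finset.mem_Icc.1 hv).1 hkv, mul_comm]
  · have : Finset.univ.filter (fun p : Nat.Partition n => k ≤ p.parts.count v) = ∅ := by
      apply Finset.filter_eq_empty_iff.2
      intro p _ hp
      have hle : Multiset.replicate k v ≤ p.parts := Multiset.le_count_iff_replicate_le.1 hp
      have hadd := congrArg Multiset.sum (Multiset.sub_add_cancel hle)
      rw [Multiset.sum_add, p.parts_sum, Multiset.sum_replicate, smul_eq_mul] at hadd
      omega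
    rw [this]; simp

lemma sum_geo (r : ℝ) (V : ℕ) :
    (1 - r) ^ 2 * ∑ v ∈ Finset.Icc 1 V, (v : ℝ) * r ^ v
      = r - r ^ (V + 1) * (1 + V * (1 - r)) := by
  induction V with
  | zero => simp
  | succ V ih =>
    rw [Finset.sum_Icc_succ_top (by omega), mul_add, ih]
    push_cast
    ring

lemma sum_geo_upper (y : ℝ) (hy : 0 < y) (V : ℕ) :
    ∑ v ∈ Finset.Icc 1 V, (v : ℝ) * Real.exp (-y) ^ v ≤ 1 / y ^ 2 := by
  have hr1 : Real.exp (-y) < 1 := by rw [Real.exp_lt_one_iff]; linarith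
  have hr0 := Real.exp_pos (-y)
  have h := sum_geo (Real.exp (-y)) V
  have h2 : (1 - Real.exp (-y)) ^ 2 * ∑ v ∈ Finset.Icc 1 V, (v : ℝ) * Real.exp (-y) ^ v
      ≤ Real.exp (-y) := by
    rw [h]
    have : 0 ≤ Real.exp (-y) ^ (V + 1) * (1 + V * (1 - Real.exp (-y))) := by
      have : 0 ≤ 1 - Real.exp (-y) := by linarith
      positivity
    linarith
  have h3 : y ^ 2 * Real.exp (-y) ≤ (1 - Real.exp (-y)) ^ 2 := by
    have hs : y / 2 ≤ Real.sinh (y / 2) := Real.self_le_sinh_iff.2 (by linarith)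
    rw [Real.sinh_eq] at hs
    set s := Real.exp (-(y / 2)) with hsdef
    have hs0 : 0 < s := Real.exp_pos _
    have e1 : Real.exp (-y) = s ^ 2 := by
      rw [hsdef, ← Real.exp_nat_mul]; congr 1; push_cast; ring
    have e2 : Real.exp (y / 2) * s = 1 := by rw [hsdef, ← Real.exp_add]; simp
    have h4 : y * s ≤ 1 - s ^ 2 := by nlinarith
    rw [e1]
    calc y ^ 2 * s ^ 2 = (y * s) ^ 2 := by ring
      _ ≤ _ := pow_le_pow_left₀ (by positivity) h4 2
  rw [le_div_iff₀ (by positivity)]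
  have hS : 0 ≤ ∑ v ∈ Finset.Icc 1 V, (v : ℝ) * Real.exp (-y) ^ v :=
    Finset.sum_nonneg fun _ _ => by positivity
  have h5 := (mul_le_mul_of_nonneg_right h3 hS).trans h2
  nlinarith

lemma sum_geo_lower (θ h M : ℝ) (hθ : 0 < θ) (hh : 0 < h) (V : ℕ)
    (hV : V * h ≤ M) (hV' : M ≤ (V + 1) * h) :
    1 / θ ^ 2 * (Real.exp (-(θ * h)) - Real.exp (-(θ * M)) * (1 + θ * M))
      ≤ h ^ 2 * ∑ v ∈ Finset.Icc 1 V, (v : ℝ) * Real.exp (-(θ * h)) ^ v := by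
  have hg := sum_geo (Real.exp (-(θ * h))) V
  have hθh : 0 < θ * h := by positivity
  have hr1 : Real.exp (-(θ * h)) < 1 := by rw [Real.exp_lt_one_iff]; linarith
  have hr2 : 1 - Real.exp (-(θ * h)) ≤ θ * h := by
    have := Real.add_one_le_exp (-(θ * h)); linarith
  have hr3 : Real.exp (-(θ * h)) ^ (V + 1) ≤ Real.exp (-(θ * M)) := by
    rw [← Real.exp_nat_mul, Real.exp_le_exp]; push_cast; nlinarith
  set r := Real.exp (-(θ * h)) with hr
  have hr0 : 0 < r := Real.exp_pos _
  have hS : 0 ≤ ∑ v ∈ Finset.Icc 1 V, (v : ℝ) * r ^ v :=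
    Finset.sum_nonneg fun _ _ => by positivity
  set S := ∑ v ∈ Finset.Icc 1 V, (v : ℝ) * r ^ v
  have h1 : (1 - r) ^ 2 ≤ (θ * h) ^ 2 := pow_le_pow_left₀ (by linarith) hr2 2
  have h2 : (V : ℝ) * (1 - r) ≤ θ * M := by
    calc (V : ℝ) * (1 - r) ≤ V * (θ * h) := by gcongr
      _ = θ * (V * h) := by ring
      _ ≤ _ := by gcongr
  have h3 : r ^ (V + 1) * (1 + V * (1 - r)) ≤ Real.exp (-(θ * M)) * (1 + θ * M) := by
    have : 0 ≤ 1 - r := by linarith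
    gcongr
  have h4 := mul_le_mul_of_nonneg_right h1 hS
  rw [one_div_mul_eq_div, div_le_iff₀ (by positivity)]
  nlinarith


lemma pcard_upper (c : ℝ) (hc : 0 < c) (hc2 : c ^ 2 = 2 * Real.pi ^ 2 / 3) (n : ℕ) :
    (pcard n : ℝ) ≤ Real.exp (c * Real.sqrt n) := by
  induction n using Nat.strong_induction_on with
  | _ n ih =>
  rcases Nat.eq_zero_or_pos n with rfl | hn
  · have : pcard 0 = 1 := by unfold pcard; simp
    simp [this]
  have hn' : (0 : ℝ) < n := by exact_mod_cast hn
  have hsq : 0 < Real.sqrt n := Real.sqrt_pos.2 hn'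
  have hss : Real.sqrt n ^ 2 = n := Real.sq_sqrt hn'.le
  set q := Real.sqrt n with hq
  set x := c / (2 * q) with hx
  have hx0 : 0 < x := by positivity
  have hrec : (n : ℝ) * pcard n = ∑ k ∈ Finset.Icc 1 n, ∑ v ∈ Finset.Icc 1 n,
      if k * v ≤ n then (v : ℝ) * pcard (n - k * v) else 0 := by
    exact_mod_cast congrArg (Nat.cast (R := ℝ)) (pcard_rec n)
  have hbound : (n : ℝ) * pcard n ≤ n * Real.exp (c * q) := by
    rw [hrec]
    calc _ ≤ ∑ k ∈ Finset.Icc 1 n, ∑ v ∈ Finset.Icc 1 n,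
          Real.exp (c * q) * ((v : ℝ) * Real.exp (-(x * k)) ^ v) := by
          refine Finset.sum_le_sum fun k hk => Finset.sum_le_sum fun v hv => ?_
          have hk1 := (Finset.mem_Icc.1 hk).1
          have hv1 := (Finset.mem_Icc.1 hv).1
          split_ifs with hkv
          · have hlt : n - k * v < n := by
              have : 0 < k * v := Nat.mul_pos hk1 hv1
              omega
            have h1 := ih _ hlt
            have h2 : Real.sqrt ((n - k * v : ℕ) : ℝ) ≤ q - k * v / (2 * q) := by
              have hle : (k : ℝ) * v ≤ n := by exact_mod_cast hkv
              have h0 : 0 ≤ q - k * v / (2 * q) := by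
                rw [sub_nonneg, div_le_iff₀ (by positivity)]; nlinarith
              rw [Real.sqrt_le_left h0, Nat.cast_sub hkv]
              have h3 : (q - k * v / (2 * q)) ^ 2
                  = q ^ 2 - k * v + (k * v / (2 * q)) ^ 2 := by
                field_simp
                ring
              rw [h3, hss]
              push_cast
              nlinarith [sq_nonneg ((k : ℝ) * v / (2 * q))]
            have h4 : Real.exp (c * Real.sqrt ((n - k * v : ℕ) : ℝ))
                ≤ Real.exp (c * q) * Real.exp (-(x * k)) ^ v := by
              rw [← Real.exp_nat_mul, ← Real.exp_add, Real.exp_le_exp]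
              calc _ ≤ c * (q - k * v / (2 * q)) := by gcongr
                _ = _ := by rw [hx]; field_simp; ring
            calc (v : ℝ) * pcard (n - k * v)
                ≤ v * (Real.exp (c * q) * Real.exp (-(x * k)) ^ v) := by
                  gcongr; exact h1.trans h4
              _ = _ := by ring
          · positivity
      _ = Real.exp (c * q) * ∑ k ∈ Finset.Icc 1 n, ∑ v ∈ Finset.Icc 1 n,
          ((v : ℝ) * Real.exp (-(x * k)) ^ v) := by
          simp only [Finset.mul_sum]
      _ ≤ Real.exp (c * q) * ∑ k ∈ Finset.Icc 1 n, (1 / x ^ 2) * (1 / (k : ℝ) ^ 2) := by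
          gcongr with k hk
          have hk1 : (0 : ℝ) < k := by exact_mod_cast (Finset.mem_Icc.1 hk).1
          refine (sum_geo_upper (x * k) (by positivity) n).trans (le_of_eq ?_)
          field_simp
      _ ≤ Real.exp (c * q) * ((1 / x ^ 2) * (Real.pi ^ 2 / 6)) := by
          rw [← Finset.mul_sum]
          gcongr
          exact sum_le_hasSum _ (fun _ _ => by positivity) hasSum_zeta_two
      _ = n * Real.exp (c * q) := by
          have : (1 / x ^ 2) * (Real.pi ^ 2 / 6) = n := by
            rw [hx, ← hss]
            field_simp
            nlinarith
          rw [this, mul_comm]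
  exact le_of_mul_le_mul_left hbound hn'

/-- The key eventual inequality for the lower bound. -/
lemma exists_params (b : ℝ) (hb : 0 < b) (hb2 : b ^ 2 < Real.pi ^ 2 / 6) :
    ∃ K : ℕ, 1 ≤ K ∧ ∃ M : ℝ, 0 < M ∧ ∀ᶠ n : ℕ in Filter.atTop,
      1 ≤ ∑ k ∈ Finset.Icc 1 K, 1 / (b * k) ^ 2 *
        (Real.exp (-(b * k * (1 / Real.sqrt n))) - Real.exp (-(b * k * M)) * (1 + b * k * M)) := by
  have hz := hasSum_zeta_two.tendsto_sum_nat
  obtain ⟨K, hK1, hK⟩ := ((Filter.eventually_ge_atTop 1).and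
    ((hz.comp (Filter.tendsto_add_atTop_nat 1)).eventually (lt_mem_nhds hb2))).exists
  have hK' : 1 < ∑ k ∈ Finset.Icc 1 K, 1 / (b * k) ^ 2 * ((1 : ℝ) - 0) := by
    have e : ∑ i ∈ Finset.range (K + 1), 1 / (i : ℝ) ^ 2
        = ∑ k ∈ Finset.Icc 1 K, 1 / (k : ℝ) ^ 2 := by
      rw [Finset.range_eq_Ico, Finset.sum_eq_sum_Ico_succ_bot (by omega)]
      simp
      rfl
    simp only [Function.comp] at hK
    rw [e] at hK
    have e2 : ∑ k ∈ Finset.Icc 1 K, 1 / (b * k) ^ 2 * ((1 : ℝ) - 0)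
        = 1 / b ^ 2 * ∑ k ∈ Finset.Icc 1 K, 1 / (k : ℝ) ^ 2 := by
      rw [Finset.mul_sum]
      refine Finset.sum_congr rfl fun k _ => ?_
      rw [mul_pow, sub_zero, mul_one, one_div_mul_one_div]
    rw [e2, one_div_mul_eq_div, one_lt_div (by positivity)]
    exact hK
  have hM : Filter.Tendsto (fun M : ℝ => ∑ k ∈ Finset.Icc 1 K, 1 / (b * k) ^ 2 *
        ((1 : ℝ) - Real.exp (-(b * k * M)) * (1 + b * k * M))) Filter.atTop
        (nhds (∑ k ∈ Finset.Icc 1 K, 1 / (b * k) ^ 2 * ((1 : ℝ) - 0))) := by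
    refine tendsto_finsetSum _ fun k hk => ?_
    refine Filter.Tendsto.const_mul _ (Filter.Tendsto.const_sub _ ?_)
    have hk1 : (0 : ℝ) < k := by exact_mod_cast (Finset.mem_Icc.1 hk).1
    have hlin : Filter.Tendsto (fun M : ℝ => b * k * M) Filter.atTop Filter.atTop :=
      Filter.tendsto_id.const_mul_atTop (by positivity)
    have h0 := (Real.tendsto_pow_mul_exp_neg_atTop_nhds_zero 0).add
      (Real.tendsto_pow_mul_exp_neg_atTop_nhds_zero 1)
    have h1 := h0.comp hlin
    simp only [add_zero] at h1
    refine h1.congr fun M => ?_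
    simp only [Function.comp]
    ring
  obtain ⟨M, hM0, hM1⟩ := ((Filter.eventually_gt_atTop 0).and
    (hM.eventually (lt_mem_nhds hK'))).exists
  refine ⟨K, hK1, M, hM0, ?_⟩
  have hn : Filter.Tendsto (fun n : ℕ => ∑ k ∈ Finset.Icc 1 K, 1 / (b * k) ^ 2 *
        (Real.exp (-(b * k * (1 / Real.sqrt n)))
          - Real.exp (-(b * k * M)) * (1 + b * k * M))) Filter.atTop
        (nhds (∑ k ∈ Finset.Icc 1 K, 1 / (b * k) ^ 2 *
        ((1 : ℝ) - Real.exp (-(b * k * M)) * (1 + b * k * M)))) := by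
    refine tendsto_finsetSum _ fun k hk => ?_
    refine Filter.Tendsto.const_mul _ (Filter.Tendsto.sub_const ?_ _)
    have hs : Filter.Tendsto (fun n : ℕ => 1 / Real.sqrt n) Filter.atTop (nhds 0) := by
      simp only [one_div]
      exact (Real.tendsto_sqrt_atTop.comp tendsto_natCast_atTop_atTop).inv_tendsto_atTop
    have h1 := (Real.continuous_exp.tendsto _).comp (hs.const_mul (b * k)).neg
    simpa [Function.comp_def] using h1
  filter_upwards [hn.eventually (lt_mem_nhds hM1)] with n hn
  exact hn.le

lemma sqrt_key (a b q t : ℝ) (ha : 0 < a) (hb : 0 < b) (hq : 0 < q) (ht0 : 0 ≤ t)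
    (htq : 0 ≤ q ^ 2 - t) (ht : t ≤ q * (1 - (a / b - 1) ^ 2) * q) :
    a * (q - Real.sqrt (q ^ 2 - t)) ≤ b * t / q := by
  have hsl : (a / b - 1) * q ≤ Real.sqrt (q ^ 2 - t) := by
    apply Real.le_sqrt_of_sq_le
    linarith
  have hs0 := Real.sqrt_nonneg (q ^ 2 - t)
  have hs2 := Real.sq_sqrt htq
  have hsq : Real.sqrt (q ^ 2 - t) ≤ q := by
    rw [Real.sqrt_le_left hq.le]; linarith
  generalize Real.sqrt (q ^ 2 - t) = s at *
  have e1 : (q - s) * (q + s) = t := by linarith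
  have e2 : a * q ≤ b * (q + s) := by
    have : a / b * q ≤ q + s := by linarith
    calc a * q = b * (a / b * q) := by field_simp
      _ ≤ _ := by gcongr
  have e3 : 0 ≤ q - s := by linarith
  rw [le_div_iff₀ hq]
  calc a * (q - s) * q = (q - s) * (a * q) := by ring
    _ ≤ (q - s) * (b * (q + s)) := mul_le_mul_of_nonneg_left e2 e3
    _ = b * ((q - s) * (q + s)) := by ring
    _ = b * t := by rw [e1]

lemma pcard_lower (a : ℝ) (ha : 0 < a) (ha2 : a ^ 2 < 2 * Real.pi ^ 2 / 3) :
    ∃ A : ℝ, 0 < A ∧ ∀ n : ℕ, A * Real.exp (a * Real.sqrt n) ≤ pcard n := by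
  have hpi := Real.pi_pos
  obtain ⟨b, hb1, hb2⟩ : ∃ b : ℝ, a / 2 < b ∧ b < Real.pi / Real.sqrt 6 := by
    apply exists_between
    rw [lt_div_iff₀ (by positivity)]
    apply lt_of_pow_lt_pow_left₀ 2 hpi.le
    rw [mul_pow, Real.sq_sqrt (by norm_num)]
    nlinarith
  have hb : 0 < b := by linarith
  have hbsq : b ^ 2 < Real.pi ^ 2 / 6 := by
    have := pow_lt_pow_left₀ hb2 hb.le (two_ne_zero)
    rwa [div_pow, Real.sq_sqrt (by norm_num)] at this
  obtain ⟨K, hK1, M, hM0, hev⟩ := exists_params b hb hbsq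
  have hab : a / b < 2 := by rw [div_lt_iff₀ hb]; linarith
  have hab0 : 0 < a / b := by positivity
  -- a threshold for the square root
  have hT : Filter.Tendsto (fun n : ℕ => Real.sqrt (n : ℝ)) Filter.atTop Filter.atTop :=
    Real.tendsto_sqrt_atTop.comp tendsto_natCast_atTop_atTop
  have hδ : 0 < 1 - (a / b - 1) ^ 2 := by nlinarith
  obtain ⟨n0, hn0⟩ := Filter.eventually_atTop.1 (((hev.and
    (hT.eventually_ge_atTop (K * M))).and
    (hT.eventually_ge_atTop (K * M / (1 - (a / b - 1) ^ 2)))).and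
    ((Filter.eventually_ge_atTop K).and (Filter.eventually_ge_atTop 1)))
  refine ⟨Real.exp (-(a * Real.sqrt n0)), Real.exp_pos _, fun n => ?_⟩
  induction n using Nat.strong_induction_on with
  | _ n ih =>
  rcases lt_or_ge n n0 with hlt | hge
  · have h1 : (1 : ℝ) ≤ pcard n := by exact_mod_cast pcard_pos n
    refine le_trans ?_ h1
    rw [← Real.exp_add, Real.exp_le_one_iff]
    have : Real.sqrt n ≤ Real.sqrt n0 := Real.sqrt_le_sqrt (by exact_mod_cast hlt.le)
    nlinarith
  obtain ⟨⟨⟨h1, h2⟩, h3⟩, hKn, hn1⟩ := hn0 n hge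
  have hn' : (0 : ℝ) < n := by exact_mod_cast hn1
  have hsq : 0 < Real.sqrt n := Real.sqrt_pos.2 hn'
  have hss : Real.sqrt n ^ 2 = n := Real.sq_sqrt hn'.le
  set q := Real.sqrt n with hq
  set A := Real.exp (-(a * Real.sqrt n0)) with hA
  have hA0 : 0 < A := Real.exp_pos _
  have hK1' : (1 : ℝ) ≤ K := by exact_mod_cast hK1
  rw [div_le_iff₀ hδ] at h3
  set V := ⌊M * q⌋₊ with hV
  have hVle : (V : ℝ) ≤ M * q := Nat.floor_le (by positivity)
  have hVlt : M * q < V + 1 := Nat.lt_floor_add_one _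
  have hVK : (K : ℝ) * V ≤ n := by
    calc (K : ℝ) * V ≤ K * (M * q) := by gcongr
      _ = (K * M) * q := by ring
      _ ≤ q * q := by gcongr
      _ = n := by rw [← hss]; ring
  have hVK' : K * V ≤ n := by exact_mod_cast hVK
  have hVn : V ≤ n := le_trans (Nat.le_mul_of_pos_left V hK1) hVK'
  have hrec : (n : ℝ) * pcard n = ∑ k ∈ Finset.Icc 1 n, ∑ v ∈ Finset.Icc 1 n,
      if k * v ≤ n then (v : ℝ) * pcard (n - k * v) else 0 := by
    exact_mod_cast congrArg (Nat.cast (R := ℝ)) (pcard_rec n)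
  have hnn : ∀ k v : ℕ, 0 ≤ if k * v ≤ n then (v : ℝ) * pcard (n - k * v) else 0 := by
    intro k v; split_ifs <;> positivity
  have hbound : (n : ℝ) * (A * Real.exp (a * q)) ≤ n * pcard n := by
    rw [hrec]
    calc (n : ℝ) * (A * Real.exp (a * q))
        ≤ (n * (A * Real.exp (a * q))) * ∑ k ∈ Finset.Icc 1 K, 1 / (b * k) ^ 2 *
        (Real.exp (-(b * k * (1 / q))) - Real.exp (-(b * k * M)) * (1 + b * k * M)) :=
          le_mul_of_one_le_right (by positivity) h1
      _ ≤ (n * (A * Real.exp (a * q))) * ∑ k ∈ Finset.Icc 1 K, (1 / q) ^ 2 *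
          ∑ v ∈ Finset.Icc 1 V, (v : ℝ) * Real.exp (-(b * k * (1 / q))) ^ v := by
          refine mul_le_mul_of_nonneg_left (Finset.sum_le_sum fun k hk => ?_) (by positivity)
          have hk1 : (0 : ℝ) < k := by exact_mod_cast (Finset.mem_Icc.1 hk).1
          apply sum_geo_lower (b * k) (1 / q) M (by positivity) (by positivity)
          · rw [mul_one_div, div_le_iff₀ hsq]; exact hVle
          · rw [mul_one_div, le_div_iff₀ hsq]; exact hVlt.le
      _ = ∑ k ∈ Finset.Icc 1 K, ∑ v ∈ Finset.Icc 1 V,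
          (v : ℝ) * (A * (Real.exp (a * q) * Real.exp (-(b * k * (1 / q))) ^ v)) := by
          simp only [Finset.mul_sum]
          refine Finset.sum_congr rfl fun k _ => Finset.sum_congr rfl fun v _ => ?_
          rw [one_div_pow, hss]
          field_simp
      _ ≤ ∑ k ∈ Finset.Icc 1 K, ∑ v ∈ Finset.Icc 1 V,
          if k * v ≤ n then (v : ℝ) * pcard (n - k * v) else 0 := by
          refine Finset.sum_le_sum fun k hk => Finset.sum_le_sum fun v hv => ?_
          obtain ⟨hk1, hkK⟩ := Finset.mem_Icc.1 hk
          obtain ⟨hv1, hvV⟩ := Finset.mem_Icc.1 hv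
          have hkvle : k * v ≤ K * V := Nat.mul_le_mul hkK hvV
          have hkv : k * v ≤ n := hkvle.trans hVK'
          rw [if_pos hkv]
          have hlt : n - k * v < n := by
            have : 0 < k * v := Nat.mul_pos hk1 hv1
            omega
          have hi := ih _ hlt
          set t : ℝ := (k : ℝ) * v with ht
          have ht0 : 0 ≤ t := by positivity
          have htK : t ≤ K * M * q := by
            calc t ≤ (K : ℝ) * V := by rw [ht]; exact_mod_cast hkvle
              _ ≤ K * (M * q) := by gcongr
              _ = _ := by ring
          have hcast : ((n - k * v : ℕ) : ℝ) = n - t := by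
            rw [Nat.cast_sub hkv, ht]; push_cast; ring
          rw [hcast] at hi
          have htn : 0 ≤ (n : ℝ) - t := by rw [← hcast]; positivity
          have hkey : a * (q - Real.sqrt ((n : ℝ) - t)) ≤ b * t / q := by
            rw [← hss]
            apply sqrt_key a b q t ha hb hsq ht0
            · rw [hss]; exact htn
            · exact htK.trans (mul_le_mul_of_nonneg_right h3 hsq.le)
          gcongr
          refine le_trans ?_ hi
          gcongr
          rw [← Real.exp_nat_mul, ← Real.exp_add, Real.exp_le_exp]
          have : (v : ℝ) * -(b * k * (1 / q)) = -(b * t / q) := by rw [ht]; ring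
          rw [this]
          linarith
      _ ≤ ∑ k ∈ Finset.Icc 1 K, ∑ v ∈ Finset.Icc 1 n,
          if k * v ≤ n then (v : ℝ) * pcard (n - k * v) else 0 := by
          refine Finset.sum_le_sum fun k _ => ?_
          exact Finset.sum_le_sum_of_subset_of_nonneg (Finset.Icc_subset_Icc_right hVn)
            (fun v _ _ => hnn k v)
      _ ≤ _ := Finset.sum_le_sum_of_subset_of_nonneg (Finset.Icc_subset_Icc_right hKn)
            (fun k _ _ => Finset.sum_nonneg fun v _ => hnn k v)
  exact le_of_mul_le_mul_left hbound hn'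

/-- **Asymptotics of the number of partitions (Hardy–Ramanujan, logarithmic form).**
As `N → ∞`, `log |𝒴_N| / N^{1/2} → π·√(2/3)`, where `𝒴_N` is the set of
partitions of `N`. -/
theorem log_card_partitions_asymptotic :
    Filter.Tendsto
      (fun N : ℕ => Real.log (Fintype.card (Nat.Partition N)) / Real.sqrt N)
      Filter.atTop (nhds (Real.pi * Real.sqrt (2 / 3))) := by
  have hpi := Real.pi_pos
  set c := Real.pi * Real.sqrt (2 / 3) with hc
  have hc0 : 0 < c := by positivity
  have hc2 : c ^ 2 = 2 * Real.pi ^ 2 / 3 := by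
    rw [hc, mul_pow, Real.sq_sqrt (by norm_num)]; ring
  change Filter.Tendsto (fun N : ℕ => Real.log (pcard N) / Real.sqrt N) _ _
  have hpos : ∀ n, (0 : ℝ) < pcard n := fun n => by exact_mod_cast pcard_pos n
  refine tendsto_order.2 ⟨fun a' ha' => ?_, fun a' ha' => ?_⟩
  · obtain ⟨a, ha1, ha2⟩ := exists_between (max_lt ha' hc0)
    have ha0 : 0 < a := (le_max_right _ _).trans_lt ha1
    have haa : a' < a := (le_max_left _ _).trans_lt ha1
    obtain ⟨A, hA0, hA⟩ := pcard_lower a ha0 (by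
      rw [← hc2]; exact pow_lt_pow_left₀ ha2 ha0.le two_ne_zero)
    have hT : Filter.Tendsto (fun n : ℕ => Real.sqrt (n : ℝ)) Filter.atTop Filter.atTop :=
      Real.tendsto_sqrt_atTop.comp tendsto_natCast_atTop_atTop
    filter_upwards [hT.eventually_gt_atTop (-Real.log A / (a - a')),
      hT.eventually_gt_atTop 0] with n h1 h2
    rw [div_lt_iff₀ (by linarith)] at h1
    rw [lt_div_iff₀ h2]
    have h3 := Real.log_le_log (by positivity) (hA n)
    rw [Real.log_mul hA0.ne' (Real.exp_pos _).ne', Real.log_exp] at h3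
    nlinarith
  · filter_upwards [Filter.eventually_gt_atTop 0] with n hn
    have h2 : 0 < Real.sqrt n := Real.sqrt_pos.2 (by exact_mod_cast hn)
    refine lt_of_le_of_lt ?_ ha'
    rw [div_le_iff₀ h2]
    have h3 := Real.log_le_log (hpos n) (pcard_upper c hc0 hc2 n)
    rwa [Real.log_exp] at h3
end

section
/- As N → ∞, the logarithm of the number of plane partitions of N is asymptotically 3·(ζ(3)/4)^{1/3}·N^{2/3}; that is, log|𝒮_N| / N^{2/3} → 3·(ζ(3)/4)^{1/3}, where ζ(3) = ∑_{k≥1} 1/k³. -/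
/-- `n : ℕ × ℕ → ℕ` is a plane partition of `N`: it is non-increasing in each
coordinate and its entries sum to `N` (the finitary sum `∑ᶠ` forces the support
to be finite when `N ≠ 0`). -/
def IsPlanePartition (N : ℕ) (n : ℕ × ℕ → ℕ) : Prop :=
  (∀ i j, n (i + 1, j) ≤ n (i, j)) ∧
  (∀ i j, n (i, j + 1) ≤ n (i, j)) ∧
  (Function.support n).Finite ∧
  ∑ᶠ p : ℕ × ℕ, n p = N

open scoped ENNReal

namespace PPart

/-- Finitely supported sequences (those occurring below are partitions). -/
abbrev X := ℕ →₀ ℕ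

/-- Interlacing of `l` below `v`. -/
def Il (l v : X) : Prop := ∀ i, v (i + 1) ≤ l i ∧ l i ≤ v i

noncomputable def sz (l : X) : ℕ := l.sum fun _ a => a

lemma sz_eq (l : X) (M : ℕ) (h : ∀ i, M ≤ i → l i = 0) : sz l = ∑ i ∈ Finset.range M, l i := by
  unfold sz
  apply Finsupp.sum_of_support_subset
  · intro i hi
    by_contra hc
    simp at hc hi
    exact hi (h i hc)
  · simp

lemma exists_bd (l : X) : ∃ M, ∀ i, M ≤ i → l i = 0 := by
  refine ⟨l.support.sup id + 1, fun i hi => ?_⟩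
  by_contra hc
  have : i ∈ l.support := by simpa using hc
  have := Finset.le_sup (f := id) this
  simp at this
  omega

lemma sz_mono {l v : X} (h : Il l v) : sz l ≤ sz v := by
  obtain ⟨M, hM⟩ := exists_bd v
  rw [sz_eq v M hM, sz_eq l M (fun i hi => by have := h i; have := hM i hi; omega)]
  exact Finset.sum_le_sum fun i _ => (h i).2

noncomputable def mkX (f : ℕ → ℕ) (h : ∃ M, ∀ i, M ≤ i → f i = 0) : X :=
  Finsupp.ofSupportFinite f (by
    obtain ⟨M, hM⟩ := h
    refine (Set.finite_lt_nat M).subset fun i hi => ?_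
    by_contra hc
    simp at hc
    exact hi (hM i hc))

@[simp] lemma mkX_apply (f h i) : mkX f h i = f i := rfl

def upF (l m k : ℕ → ℕ) (c : ℕ) : ℕ → ℕ
  | 0 => max (l 0) (m 0) + c
  | i + 1 => max (l (i + 1)) (m (i + 1)) + min (l i) (m i) - k i

lemma bd2 (l m : X) : ∃ M, ∀ i, M ≤ i → l i = 0 ∧ m i = 0 := by
  obtain ⟨M, hM⟩ := exists_bd l
  obtain ⟨M', hM'⟩ := exists_bd m
  exact ⟨M + M', fun i hi => ⟨hM i (by omega), hM' i (by omega)⟩⟩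

lemma up_bd (l m k : X) (c : ℕ) : ∃ M, ∀ i, M ≤ i → upF l m k c i = 0 := by
  obtain ⟨M, hM⟩ := bd2 l m
  refine ⟨M + 1, fun i hi => ?_⟩
  cases i with
  | zero => omega
  | succ i =>
    have h1 := hM i (by omega)
    have h2 := hM (i + 1) (by omega)
    simp [upF, h1.1, h1.2, h2.1, h2.2]

lemma dn_bd (l m v : X) :
    ∃ M, ∀ i, M ≤ i → max (l (i + 1)) (m (i + 1)) + min (l i) (m i) - v (i + 1) = 0 := by
  obtain ⟨M, hM⟩ := bd2 l m
  refine ⟨M + 1, fun i hi => ?_⟩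
  have h1 := hM i (by omega)
  have h2 := hM (i + 1) (by omega)
  simp [h1.1, h1.2, h2.1, h2.2]

/-- The local toggle bijection. -/
noncomputable def tog (l m : X) : {v : X // Il l v ∧ Il m v} ≃ {k : X // Il k l ∧ Il k m} × ℕ where
  toFun v := ⟨⟨mkX (fun i => max (l (i + 1)) (m (i + 1)) + min (l i) (m i) - v.1 (i + 1))
      (dn_bd l m v.1), by
        constructor <;> intro i <;> have h1 := v.2.1 i <;> have h2 := v.2.2 i <;>
        have h3 := v.2.1 (i + 1) <;> have h4 := v.2.2 (i + 1) <;> simp <;> omega⟩,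
      v.1 0 - max (l 0) (m 0)⟩
  invFun k := ⟨mkX (upF l m k.1.1 k.2) (up_bd l m k.1.1 k.2), by
    constructor <;> intro i <;> have h1 := k.1.2.1 i <;> have h2 := k.1.2.2 i <;>
    rcases i with _ | i <;> simp [upF] at *
    · omega
    · have h3 := k.1.2.1 i
      have h4 := k.1.2.2 i
      omega
    · omega
    · have h3 := k.1.2.1 i
      have h4 := k.1.2.2 i
      omega⟩
  left_inv v := by
    ext i
    have h1 := v.2.1 i
    have h2 := v.2.2 i
    rcases i with _ | i <;> simp [upF]
    · omega
    · have h3 := v.2.1 i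
      have h4 := v.2.2 i
      omega
  right_inv k := by
    ext i
    · have h1 := k.1.2.1 i
      have h2 := k.1.2.2 i
      simp [upF]
      omega
    · simp [upF]

lemma tog_sz (l m : X) (k : {k : X // Il k l ∧ Il k m} × ℕ) :
    sz ((tog l m).symm k).1 + sz k.1.1 = sz l + sz m + k.2 := by
  obtain ⟨M, hM⟩ := bd2 l m
  have hk : ∀ i, M ≤ i → k.1.1 i = 0 := fun i hi => by
    have := k.1.2.1 i
    have := hM i hi
    omega
  have hv : ∀ i, M + 1 ≤ i → ((tog l m).symm k).1 i = 0 := fun i hi => by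
    rcases i with _ | i
    · omega
    have := ((tog l m).symm k).2.1 i
    have := hM i (by omega)
    omega
  rw [sz_eq _ _ hv, sz_eq _ _ hk, sz_eq l (M + 1) (fun i hi => (hM i (by omega)).1),
    sz_eq m (M + 1) (fun i hi => (hM i (by omega)).2), Finset.sum_range_succ',
    ← Finset.sum_add_distrib, add_right_comm, ← Finset.sum_add_distrib]
  have e1 : ∀ i ∈ Finset.range M, ((tog l m).symm k).1 (i + 1) + k.1.1 i =
      max (l (i + 1)) (m (i + 1)) + min (l i) (m i) := fun i _ => by
    have h1 := k.1.2.1 i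
    have h2 := k.1.2.2 i
    simp [tog, upF]
    omega
  rw [Finset.sum_congr rfl e1, Finset.sum_add_distrib]
  have e2 : ∀ i ∈ Finset.range (M + 1), l i + m i = max (l i) (m i) + min (l i) (m i) :=
    fun i _ => (max_add_min _ _).symm
  rw [Finset.sum_congr rfl e2, Finset.sum_add_distrib, Finset.sum_range_succ',
    Finset.sum_range_succ (fun i => min (l i) (m i)) M]
  have := hM M le_rfl
  simp [tog, upF, this.1, this.2]
  omega

open Classical in
/-- Summation over larger interlacing sequences. -/
noncomputable def A (x : ℝ≥0∞) (f : X → ℝ≥0∞) (l : X) : ℝ≥0∞ :=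
  ∑' v : X, if Il l v then x ^ (sz v - sz l) * f v else 0

open Classical in
/-- Summation over smaller interlacing sequences. -/
noncomputable def B (y : ℝ≥0∞) (f : X → ℝ≥0∞) (v : X) : ℝ≥0∞ :=
  ∑' l : X, if Il l v then y ^ (sz v - sz l) * f l else 0

open Classical in
lemma kernel_comm (x y : ℝ≥0∞) (l m : X) :
    (∑' v : X, if Il l v ∧ Il m v then x ^ (sz v - sz l) * y ^ (sz v - sz m) else 0) =
    (1 - x * y)⁻¹ * ∑' k : X, if Il k l ∧ Il k m then
      y ^ (sz l - sz k) * x ^ (sz m - sz k) else 0 := by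
  have conv : ∀ (P : X → Prop) [DecidablePred P] (g : X → ℝ≥0∞), (∑' v : X, if P v then g v else 0) =
      ∑' v : {v // P v}, g v := fun P _ g => by
    refine Eq.trans ?_ (tsum_subtype {v | P v} g).symm
    simp [Set.indicator_apply]
  rw [conv (fun v => Il l v ∧ Il m v), conv (fun k => Il k l ∧ Il k m), ← (tog l m).symm.tsum_eq, ENNReal.tsum_prod', ← ENNReal.tsum_mul_left]
  refine tsum_congr fun k => ?_
  rw [← ENNReal.tsum_geometric, ← ENNReal.tsum_mul_right]
  refine tsum_congr fun c => ?_
  have h := tog_sz l m (k, c)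
  have h1 := sz_mono k.2.1
  have h2 := sz_mono k.2.2
  simp only at h
  have e1 : sz ((tog l m).symm (k, c)).1 - sz l = c + (sz m - sz k.1) := by omega
  have e2 : sz ((tog l m).symm (k, c)).1 - sz m = c + (sz l - sz k.1) := by omega
  rw [e1, e2, pow_add, pow_add, mul_pow]
  ring

open Classical in
lemma AB_comm (x y : ℝ≥0∞) (f : X → ℝ≥0∞) (l : X) :
    A x (B y f) l = (1 - x * y)⁻¹ * B y (A x f) l := by
  have h1 : A x (B y f) l = ∑' m, (∑' v : X, if Il l v ∧ Il m v then
      x ^ (sz v - sz l) * y ^ (sz v - sz m) else 0) * f m := by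
    simp_rw [← ENNReal.tsum_mul_right]
    rw [ENNReal.tsum_comm]
    refine tsum_congr fun v => ?_
    split_ifs with h
    · rw [B, ← ENNReal.tsum_mul_left]
      refine tsum_congr fun m => ?_
      by_cases h' : Il m v <;> simp [h, h', mul_assoc]
    · simp [h]
  have h2 : B y (A x f) l = ∑' m, (∑' k : X, if Il k l ∧ Il k m then
      y ^ (sz l - sz k) * x ^ (sz m - sz k) else 0) * f m := by
    simp_rw [← ENNReal.tsum_mul_right]
    rw [ENNReal.tsum_comm]
    refine tsum_congr fun v => ?_
    split_ifs with h
    · rw [A, ← ENNReal.tsum_mul_left]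
      refine tsum_congr fun m => ?_
      by_cases h' : Il v m <;> simp [h, h', mul_assoc]
    · simp [h]
  rw [h1, h2, ← ENNReal.tsum_mul_left]
  refine tsum_congr fun m => ?_
  rw [kernel_comm, mul_assoc]

open Classical in
noncomputable def dl (l : X) : ℝ≥0∞ := if l = 0 then 1 else 0

lemma Il_zero {l : X} : Il l 0 ↔ l = 0 := by
  constructor
  · intro h
    ext i
    have := (h i).2
    simpa using this
  · rintro rfl i
    simp

lemma A_dl (x : ℝ≥0∞) : A x dl = dl := by
  funext l
  unfold A
  rw [tsum_eq_single 0]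
  · by_cases h : l = 0 <;> simp [h, Il_zero, dl]
  · intro v hv
    simp [dl, hv]

lemma A_smul (x c : ℝ≥0∞) (f : X → ℝ≥0∞) (l : X) : A x (fun v => c * f v) l = c * A x f l := by
  unfold A
  rw [← ENNReal.tsum_mul_left]
  refine tsum_congr fun v => ?_
  split_ifs <;> ring

lemma B_smul (x c : ℝ≥0∞) (f : X → ℝ≥0∞) (l : X) : B x (fun v => c * f v) l = c * B x f l := by
  unfold B
  rw [← ENNReal.tsum_mul_left]
  refine tsum_congr fun v => ?_
  split_ifs <;> ring

lemma AB_dual (x : ℝ≥0∞) (f g : X → ℝ≥0∞) : ∑' l, B x f l * g l = ∑' l, f l * A x g l := by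
  unfold A B
  simp_rw [← ENNReal.tsum_mul_right, ← ENNReal.tsum_mul_left]
  rw [ENNReal.tsum_comm]
  refine tsum_congr fun v => tsum_congr fun l => ?_
  split_ifs <;> ring

/-- Iterated `B` (a Schur function of a list of variables). -/
noncomputable def C (ys : List ℝ≥0∞) : X → ℝ≥0∞ := ys.foldr B dl

lemma A_C (x : ℝ≥0∞) (ys : List ℝ≥0∞) (l : X) :
    A x (C ys) l = (ys.map fun y => (1 - x * y)⁻¹).prod * C ys l := by
  induction ys generalizing l with
  | nil => simp [C, A_dl]
  | cons y ys ih =>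
    have : C (y :: ys) = B y (C ys) := rfl
    rw [this, AB_comm, funext ih, B_smul]
    simp [mul_assoc]

lemma cauchy (xs ys : List ℝ≥0∞) : ∑' l, C xs l * C ys l =
    (xs.map fun x => (ys.map fun y => (1 - x * y)⁻¹).prod).prod := by
  induction xs with
  | nil =>
    simp only [List.map_nil, List.prod_nil]
    rw [tsum_eq_single 0]
    · simp only [C, List.foldr_nil, dl, if_true, one_mul]
      induction ys with
      | nil => simp [dl]
      | cons y ys ih =>
        simp only [List.foldr_cons, B]
        rw [tsum_eq_single 0]
        · simpa [Il_zero] using ih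
        · intro l hl
          simp [Il_zero, hl]
    · intro l hl
      simp [C, dl, hl]
  | cons x xs ih =>
    have : C (x :: xs) = B x (C xs) := rfl
    rw [this, AB_dual]
    simp_rw [A_C, ← mul_assoc, mul_comm (C xs _), mul_assoc]
    rw [ENNReal.tsum_mul_left, ih]
    simp

end PPart

namespace PPart

/-- Half arrays with main diagonal `l` and `r` further (possibly nonzero) diagonals. -/
abbrev Half (r : ℕ) (l : X) :=
  {h : ℕ → X // h 0 = l ∧ (∀ j, Il (h (j + 1)) (h j)) ∧ ∀ j, r ≤ j → h j = 0}

noncomputable def hw (r : ℕ) (h : ℕ → X) : ℕ := ∑ j ∈ Finset.range r, sz (h (j + 1))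

noncomputable def G (q : ℝ≥0∞) (r : ℕ) (l : X) : ℝ≥0∞ := ∑' h : Half r l, q ^ hw r h.1

def consX (l : X) (h : ℕ → X) : ℕ → X
  | 0 => l
  | j + 1 => h j

def halfEquiv (r : ℕ) (l : X) : Half (r + 1) l ≃ Σ k : {k : X // Il k l}, Half r k.1 where
  toFun h := ⟨⟨h.1 1, by have := h.2.2.1 0; rw [h.2.1] at this; exact this⟩,
    ⟨fun j => h.1 (j + 1), rfl, fun j => h.2.2.1 (j + 1), fun j hj => h.2.2.2 _ (by omega)⟩⟩
  invFun s := ⟨consX l s.2.1, rfl, fun j => by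
      rcases j with _ | j
      · simp only [consX]
        rw [s.2.2.1]
        exact s.1.2
      · exact s.2.2.2.1 j, fun j hj => by
      rcases j with _ | j
      · omega
      · exact s.2.2.2.2 j (by omega)⟩
  left_inv h := by
    apply Subtype.ext
    funext j
    rcases j with _ | j
    · exact h.2.1.symm
    · rfl
  right_inv := by
    rintro ⟨⟨k, hk⟩, ⟨h, h1, h2⟩⟩
    have h1' : h 0 = k := h1
    subst h1'
    rfl

lemma sz_zero : sz 0 = 0 := by simp [sz]

lemma Il_zero_zero : Il 0 0 := Il_zero.2 rfl

lemma G_zero (q : ℝ≥0∞) : G q 0 = dl := by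
  funext l
  unfold G dl
  split_ifs with h
  · subst h
    rw [tsum_eq_single ⟨fun _ => 0, rfl, fun _ => Il_zero_zero, fun _ _ => rfl⟩]
    · simp [hw]
    · intro h hh
      exact absurd (Subtype.ext (funext fun j => h.2.2.2 j (Nat.zero_le _))) hh
  · have : IsEmpty (Half 0 l) := ⟨fun hh => h (by rw [← hh.2.1]; exact hh.2.2.2 0 le_rfl)⟩
    simp

lemma G_succ (q : ℝ≥0∞) (r : ℕ) (l : X) :
    G q (r + 1) l = B 1 (fun k => q ^ sz k * G q r k) l := by
  classical
  unfold G B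
  rw [← (halfEquiv r l).symm.tsum_eq, ENNReal.tsum_sigma']
  have e : ∀ (P : X → Prop) [DecidablePred P] (g : X → ℝ≥0∞),
      (∑' v : X, if P v then g v else 0) =
      ∑' v : {v // P v}, g v := fun P _ g => by
    refine Eq.trans ?_ (tsum_subtype {v | P v} g).symm
    simp [Set.indicator_apply]
  simp only [one_pow, one_mul]
  rw [e (fun k => Il k l)]
  refine tsum_congr fun k => ?_
  rw [← ENNReal.tsum_mul_left]
  refine tsum_congr fun h => ?_
  have : hw (r + 1) ((halfEquiv r l).symm ⟨k, h⟩).1 = sz k.1 + hw r h.1 := by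
    unfold hw
    rw [Finset.sum_range_succ', add_comm]
    congr 1
    change sz (h.1 0) = _
    rw [h.2.1]
  rw [this, pow_add]

lemma Q_C (q : ℝ≥0∞) (ys : List ℝ≥0∞) (l : X) :
    q ^ sz l * C ys l = C (ys.map (q * ·)) l := by
  induction ys generalizing l with
  | nil =>
    by_cases h : l = 0 <;> simp [C, dl, h, sz_zero]
  | cons y ys ih =>
    have e1 : C (y :: ys) = B y (C ys) := rfl
    have e2 : C ((y :: ys).map (q * ·)) = B (q * y) (C (ys.map (q * ·))) := rfl
    rw [e1, e2, ← funext ih]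
    unfold B
    rw [← ENNReal.tsum_mul_left]
    refine tsum_congr fun k => ?_
    split_ifs with h
    · have := sz_mono h
      have e : sz l = (sz l - sz k) + sz k := by omega
      calc q ^ sz l * (y ^ (sz l - sz k) * C ys k)
          = q ^ ((sz l - sz k) + sz k) * (y ^ (sz l - sz k) * C ys k) := by rw [← e]
        _ = _ := by rw [pow_add, mul_pow]; ring
    · simp

lemma G_eq_C (q : ℝ≥0∞) (r : ℕ) : G q r = C ((List.range r).map (q ^ ·)) := by
  induction r with
  | zero => rw [G_zero]; rfl
  | succ r ih =>
    funext l
    rw [G_succ, ih]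
    simp_rw [Q_C]
    have : (List.range (r + 1)).map (q ^ ·) =
        1 :: ((List.range r).map (q ^ ·)).map (q * ·) := by
      rw [List.range_succ_eq_map]
      simp [pow_succ']
    rw [this]
    rfl

lemma sum_GG (q : ℝ≥0∞) (r : ℕ) : ∑' l, q ^ sz l * (G q r l * G q r l) =
    ∏ i ∈ Finset.range r, ∏ j ∈ Finset.range r, (1 - q ^ (i + j + 1))⁻¹ := by
  simp_rw [← mul_assoc, G_eq_C, Q_C]
  rw [cauchy]
  have key : ∀ f : ℕ → ℝ≥0∞, ((List.range r).map f).prod = ∏ i ∈ Finset.range r, f i := by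
    intro f
    rw [← List.prod_toFinset f (List.nodup_range)]
    congr 1
    ext; simp
  simp only [List.map_map, Function.comp_def]
  rw [key]
  refine Finset.prod_congr rfl fun i _ => ?_
  rw [key]
  refine Finset.prod_congr rfl fun j _ => ?_
  congr 2
  ring

/-- Plane partitions in an `r × r` box. -/
abbrev PPr (r : ℕ) := {n : ℕ × ℕ → ℕ // (∀ i j, n (i + 1, j) ≤ n (i, j)) ∧
  (∀ i j, n (i, j + 1) ≤ n (i, j)) ∧ ∀ i j, (r ≤ i ∨ r ≤ j) → n (i, j) = 0}

abbrev Pr (r : ℕ) := {p : (ℕ → X) × (ℕ → X) // p.1 0 = p.2 0 ∧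
  ((∀ j, Il (p.1 (j + 1)) (p.1 j)) ∧ ∀ j, r ≤ j → p.1 j = 0) ∧
  ((∀ j, Il (p.2 (j + 1)) (p.2 j)) ∧ ∀ j, r ≤ j → p.2 j = 0)}

def prEquiv (r : ℕ) : Pr r ≃ Σ l : X, Half r l × Half r l where
  toFun p := ⟨p.1.1 0, ⟨p.1.1, rfl, p.2.2.1⟩, ⟨p.1.2, p.2.1.symm, p.2.2.2⟩⟩
  invFun s := ⟨(s.2.1.1, s.2.2.1), s.2.1.2.1.trans s.2.2.2.1.symm, s.2.1.2.2, s.2.2.2.2⟩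
  left_inv p := rfl
  right_inv := by
    rintro ⟨l, ⟨h, rfl, _⟩, ⟨h', e, _⟩⟩
    rfl

def glue (a b : ℕ → X) : ℕ × ℕ → ℕ := fun p =>
  if p.1 ≤ p.2 then a (p.2 - p.1) p.1 else b (p.1 - p.2) p.2

lemma Il_len {h : ℕ → X} {r : ℕ} (h1 : ∀ j, Il (h (j + 1)) (h j)) (h2 : ∀ j, r ≤ j → h j = 0) :
    ∀ i j, r ≤ i + j → h j i = 0 := by
  intro i
  induction i with
  | zero => intro j hj; rw [h2 j (by omega)]; rfl
  | succ i ih =>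
    intro j hj
    have := (h1 j i).1
    have := ih (j + 1) (by omega)
    omega

noncomputable def ppEquiv (r : ℕ) : PPr r ≃ Pr r where
  toFun n := ⟨(fun j => mkX (fun i => n.1 (i, i + j)) ⟨r, fun i hi => n.2.2.2 _ _ (.inl hi)⟩,
    fun j => mkX (fun i => n.1 (i + j, i)) ⟨r, fun i hi => n.2.2.2 _ _ (.inr hi)⟩), rfl,
    ⟨fun j i => ⟨by
      have := n.2.1 i (i + 1 + j)
      simpa [add_assoc, add_comm, add_left_comm] using this, n.2.2.1 i (i + j)⟩, fun j hj => by
      ext i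
      exact n.2.2.2 _ _ (.inr (by omega))⟩,
    ⟨fun j i => ⟨by
      have := n.2.2.1 (i + 1 + j) i
      simpa [add_assoc, add_comm, add_left_comm] using this, n.2.1 (i + j) i⟩, fun j hj => by
      ext i
      exact n.2.2.2 _ _ (.inl (by omega))⟩⟩
  invFun p := ⟨glue p.1.1 p.1.2, by
      intro i j
      unfold glue
      dsimp only
      rcases lt_trichotomy i j with h | h | h
      · obtain ⟨d, rfl⟩ := Nat.exists_eq_add_of_lt h
        rw [if_pos (by omega), if_pos (by omega)]
        have := (p.2.2.1.1 d i).1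
        rw [show i + d + 1 - (i + 1) = d by omega, show i + d + 1 - i = d + 1 by omega]
        exact this
      · subst h
        rw [if_neg (by omega), if_pos (by omega)]
        have := (p.2.2.2.1 0 i).2
        rw [show i + 1 - i = 0 + 1 by omega, Nat.sub_self, p.2.1]
        exact this
      · obtain ⟨d, rfl⟩ := Nat.exists_eq_add_of_lt h
        rw [if_neg (by omega), if_neg (by omega)]
        have := (p.2.2.2.1 (d + 1) j).2
        rw [show j + d + 1 + 1 - j = d + 1 + 1 by omega, show j + d + 1 - j = d + 1 by omega]
        exact this, by
      intro i j
      unfold glue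
      dsimp only
      rcases lt_or_ge j i with h | h
      · obtain ⟨d, rfl⟩ := Nat.exists_eq_add_of_lt h
        have := (p.2.2.2.1 d j).1
        rw [if_neg (show ¬ (j + d + 1 ≤ j) by omega), show j + d + 1 - j = d + 1 by omega]
        split_ifs with h'
        · have h0 : d = 0 := by omega
          subst h0
          simp only [add_zero, zero_add, Nat.sub_self] at *
          rw [p.2.1]
          exact this
        · rw [show j + d + 1 - (j + 1) = d by omega]
          exact this
      · obtain ⟨d, rfl⟩ := Nat.exists_eq_add_of_le h
        rw [if_pos (by omega), if_pos (by omega)]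
        have := (p.2.2.1.1 d i).2
        rw [show i + d + 1 - i = d + 1 by omega, show i + d - i = d by omega]
        exact this, by
      intro i j hij
      unfold glue
      dsimp only
      split_ifs with h
      · exact Il_len p.2.2.1.1 p.2.2.1.2 _ _ (by omega)
      · exact Il_len p.2.2.2.1 p.2.2.2.2 _ _ (by omega)⟩
  left_inv n := by
    apply Subtype.ext
    funext ⟨i, j⟩
    simp only [glue, mkX_apply]
    split_ifs with h
    · rw [Nat.add_sub_cancel' h]
    · rw [Nat.add_sub_cancel' (by omega)]
  right_inv p := by
    apply Subtype.ext
    refine Prod.ext ?_ ?_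
    · funext j
      ext i
      simp [glue]
    · funext j
      ext i
      simp only [glue, mkX_apply]
      split_ifs with h
      · have : j = 0 := by omega
        subst this
        simp [p.2.1]
      · simp

def dgEquiv : (ℕ × ℕ) ⊕ (ℕ × ℕ) ≃ ℕ × ℕ where
  toFun := Sum.elim (fun p => (p.1, p.1 + p.2)) (fun p => (p.1 + p.2 + 1, p.1))
  invFun p := if p.1 ≤ p.2 then .inl (p.1, p.2 - p.1) else .inr (p.2, p.1 - p.2 - 1)
  left_inv := by
    rintro (⟨i, j⟩ | ⟨i, j⟩)
    · simp
    · refine (if_neg (show ¬ (i + j + 1 ≤ i) by omega)).trans ?_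
      change Sum.inr (i, i + j + 1 - i - 1) = _
      congr 2
      omega
  right_inv := by
    rintro ⟨i, j⟩
    dsimp only
    split_ifs with h
    · simp [h]
    · simp only [Sum.elim_inr, Prod.mk.injEq, and_true]
      omega

lemma tot_eq (r : ℕ) (n : PPr r) : ∑ᶠ p, n.1 p =
    sz ((ppEquiv r n).1.1 0) + (hw r (ppEquiv r n).1.1 + hw r (ppEquiv r n).1.2) := by
  have h0 : ∑ᶠ p, n.1 p = ∑ p ∈ Finset.range r ×ˢ Finset.range r, n.1 p := by
    apply finsum_eq_sum_of_support_subset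
    rintro ⟨i, j⟩ hp
    by_contra hc
    refine hp (n.2.2.2 _ _ ?_)
    simp at hc
    by_cases hi : i < r
    · exact .inr (hc hi)
    · exact .inl (by omega)
  have hs : ∀ j, sz ((ppEquiv r n).1.1 j) = ∑ i ∈ Finset.range r, n.1 (i, i + j) := fun j =>
    sz_eq _ _ fun i hi => n.2.2.2 _ _ (.inl hi)
  have hs' : ∀ j, sz ((ppEquiv r n).1.2 j) = ∑ i ∈ Finset.range r, n.1 (i + j, i) := fun j =>
    sz_eq _ _ fun i hi => n.2.2.2 _ _ (.inr hi)
  have e1 : sz ((ppEquiv r n).1.1 0) + hw r (ppEquiv r n).1.1 =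
      ∑ j ∈ Finset.range (r + 1), ∑ i ∈ Finset.range r, n.1 (i, i + j) := by
    rw [Finset.sum_range_succ', add_comm]
    simp only [hw, hs]
  have e2 : hw r (ppEquiv r n).1.2 =
      ∑ j ∈ Finset.range r, ∑ i ∈ Finset.range r, n.1 (i + j + 1, i) := by
    simp only [hw, hs', add_assoc]
  rw [← add_assoc, e1, e2, h0]
  have : (∑' p : ℕ × ℕ, (n.1 p : ℝ≥0∞)) =
      ∑' j, ∑' i, (n.1 (i, i + j) : ℝ≥0∞) + ∑' j, ∑' i, (n.1 (i + j + 1, i) : ℝ≥0∞) := by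
    rw [← dgEquiv.tsum_eq, ENNReal.summable.tsum_sum ENNReal.summable]
    rw [ENNReal.tsum_prod', ENNReal.tsum_prod', ENNReal.tsum_comm]
    congr 1
    rw [ENNReal.tsum_comm]
    rfl
  rw [tsum_eq_sum (s := Finset.range r ×ˢ Finset.range r),
    tsum_eq_sum (s := Finset.range (r + 1)), tsum_eq_sum (s := Finset.range r)] at this
  · have a1 : ∀ j, (∑' i, (n.1 (i, i + j) : ℝ≥0∞)) =
        ∑ i ∈ Finset.range r, (n.1 (i, i + j) : ℝ≥0∞) := fun j => tsum_eq_sum fun i hi => by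
      rw [n.2.2.2 _ _ (.inl (by simpa using hi))]; simp
    have a2 : ∀ j, (∑' i, (n.1 (i + j + 1, i) : ℝ≥0∞)) =
        ∑ i ∈ Finset.range r, (n.1 (i + j + 1, i) : ℝ≥0∞) := fun j => tsum_eq_sum fun i hi => by
      rw [n.2.2.2 _ _ (.inr (by simpa using hi))]; simp
    simp only [a1, a2] at this
    exact_mod_cast this
  · intro j hj
    simp only [Finset.mem_range, not_lt] at hj
    rw [ENNReal.tsum_eq_zero]
    intro i
    rw [n.2.2.2 _ _ (.inl (by omega))]; simp
  · intro j hj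
    simp only [Finset.mem_range, not_lt] at hj
    rw [ENNReal.tsum_eq_zero]
    intro i
    rw [n.2.2.2 _ _ (.inr (by omega))]; simp
  · rintro ⟨i, j⟩ hp
    rw [n.2.2.2]; · simp
    simp at hp
    by_cases hi : i < r
    · exact .inr (hp hi)
    · exact .inl (by omega)

/-- MacMahon's formula for plane partitions in a box with square base. -/
lemma macmahon_box (q : ℝ≥0∞) (r : ℕ) : ∑' n : PPr r, q ^ (∑ᶠ p, n.1 p) =
    ∏ i ∈ Finset.range r, ∏ j ∈ Finset.range r, (1 - q ^ (i + j + 1))⁻¹ := by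
  rw [← sum_GG]
  simp_rw [tot_eq]
  rw [(ppEquiv r).tsum_eq (fun p : Pr r => q ^ (sz (p.1.1 0) + (hw r p.1.1 + hw r p.1.2))),
    ← (prEquiv r).symm.tsum_eq, ENNReal.tsum_sigma']
  refine tsum_congr fun l => ?_
  rw [ENNReal.tsum_prod']
  unfold G
  rw [← ENNReal.tsum_mul_right, ← ENNReal.tsum_mul_left]
  refine tsum_congr fun h => ?_
  rw [← ENNReal.tsum_mul_left, ← ENNReal.tsum_mul_left]
  refine tsum_congr fun h' => ?_
  change q ^ (sz (h.1 0) + (hw r h.1 + hw r h'.1)) = _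
  rw [h.2.1, pow_add, pow_add]

end PPart

namespace PPart

noncomputable def g (u : ℝ) : ℝ := Real.exp (-u) / (1 - Real.exp (-u)) ^ 2

noncomputable def phi (t : ℝ) : ℝ := ∑' m : ℕ, g (((m : ℝ) + 1) * t) / ((m : ℝ) + 1)

lemma g_eq (u : ℝ) : g u = 1 / (2 * Real.sinh (u / 2)) ^ 2 := by
  unfold g
  have e : 2 * Real.sinh (u / 2) = Real.exp (u / 2) * (1 - Real.exp (-u)) := by
    rw [Real.sinh_eq, mul_sub, ← Real.exp_add]
    ring_nf
  rw [e, mul_pow, ← Real.exp_nat_mul, Real.exp_neg]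
  have : ((2 : ℕ) : ℝ) * (u / 2) = u := by push_cast; ring
  rw [this, div_eq_mul_inv, one_div, mul_inv]

lemma g_nonneg (u : ℝ) : 0 ≤ g u := by
  rw [g_eq]; positivity

lemma g_le {u : ℝ} (hu : 0 < u) : g u ≤ 1 / u ^ 2 := by
  rw [g_eq]
  have : u / 2 ≤ Real.sinh (u / 2) := Real.self_le_sinh_iff.2 (by positivity)
  apply one_div_le_one_div_of_le (by positivity)
  apply pow_le_pow_left₀ hu.le
  linarith

noncomputable def Zt : ℝ := ∑' k : ℕ, 1 / ((k : ℝ) + 1) ^ 3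

lemma summable_Z : Summable fun k : ℕ => 1 / ((k : ℝ) + 1) ^ 3 := by
  have := (summable_nat_add_iff 1).2 (Real.summable_one_div_nat_pow.2 (by norm_num : 1 < 3))
  simpa using this

lemma Zt_pos : 0 < Zt :=
  summable_Z.tsum_pos (fun k => by positivity) 0 (by norm_num)

lemma term_le {t : ℝ} (ht : 0 < t) (m : ℕ) :
    g (((m : ℝ) + 1) * t) / ((m : ℝ) + 1) ≤ 1 / t ^ 2 * (1 / ((m : ℝ) + 1) ^ 3) := by
  have hm : (0 : ℝ) < (m : ℝ) + 1 := by positivity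
  calc _ ≤ (1 / (((m : ℝ) + 1) * t) ^ 2) / ((m : ℝ) + 1) := by
        gcongr; exact g_le (by positivity)
    _ = _ := by field_simp

lemma term_nonneg (t : ℝ) (m : ℕ) : 0 ≤ g (((m : ℝ) + 1) * t) / ((m : ℝ) + 1) :=
  div_nonneg (g_nonneg _) (by positivity)

lemma summable_phi {t : ℝ} (ht : 0 < t) :
    Summable fun m : ℕ => g (((m : ℝ) + 1) * t) / ((m : ℝ) + 1) :=
  Summable.of_nonneg_of_le (term_nonneg t) (term_le ht) (summable_Z.mul_left _)

lemma phi_le {t : ℝ} (ht : 0 < t) : phi t ≤ Zt / t ^ 2 := by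
  have := (summable_phi ht).tsum_le_tsum (term_le ht) (summable_Z.mul_left _)
  rw [tsum_mul_left] at this
  unfold phi Zt
  calc _ ≤ _ := this
    _ = _ := by ring

open Filter Topology in
lemma sinh_lim : Tendsto (fun v : ℝ => Real.sinh v / v) (𝓝[>] 0) (𝓝 1) := by
  have h := (Real.hasDerivAt_sinh 0).tendsto_slope_zero_right
  simp only [Real.cosh_zero, zero_add, Real.sinh_zero, sub_zero, smul_eq_mul] at h
  refine h.congr fun v => ?_
  rw [div_eq_inv_mul]

open Filter Topology in
lemma phi_lim : Tendsto (fun t : ℝ => t ^ 2 * phi t) (𝓝[>] 0) (𝓝 Zt) := by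
  unfold phi Zt
  simp_rw [← tsum_mul_left]
  refine tendsto_tsum_of_dominated_convergence summable_Z ?_ ?_
  · intro m
    have hm : (0 : ℝ) < (m : ℝ) + 1 := by positivity
    have h1 : Tendsto (fun t : ℝ => ((m : ℝ) + 1) * t / 2) (𝓝[>] 0) (𝓝[>] 0) := by
      refine tendsto_nhdsWithin_iff.2 ⟨?_, ?_⟩
      · have : Tendsto (fun t : ℝ => ((m : ℝ) + 1) * t / 2) (𝓝 0) (𝓝 (((m : ℝ) + 1) * 0 / 2)) :=
          Continuous.tendsto (by fun_prop) 0
        simp only [mul_zero, zero_div] at this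
        exact this.mono_left nhdsWithin_le_nhds
      · filter_upwards [self_mem_nhdsWithin] with t ht
        have : (0 : ℝ) < t := ht
        simp only [Set.mem_Ioi]
        positivity
    have h2 := (((sinh_lim.comp h1).inv₀ one_ne_zero).pow 2).const_mul (1 / ((m : ℝ) + 1) ^ 3)
    simp only [inv_one, one_pow, mul_one] at h2
    refine h2.congr' ?_
    filter_upwards [self_mem_nhdsWithin] with t ht
    have ht : (0 : ℝ) < t := ht
    have hs : 0 < Real.sinh (((m : ℝ) + 1) * t / 2) := Real.sinh_pos_iff.2 (by positivity)
    simp only [Function.comp_apply]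
    rw [g_eq]
    field_simp
  · filter_upwards [self_mem_nhdsWithin] with t ht m
    have ht : (0 : ℝ) < t := ht
    rw [Real.norm_of_nonneg (mul_nonneg (by positivity) (term_nonneg t m))]
    calc _ ≤ t ^ 2 * (1 / t ^ 2 * (1 / ((m : ℝ) + 1) ^ 3)) := by
          gcongr; exact term_le ht m
      _ = _ := by field_simp

lemma hasSum_geo2 {x : ℝ} (h0 : 0 ≤ x) (h1 : x < 1) :
    HasSum (fun p : ℕ × ℕ => x ^ (p.1 + p.2 + 1)) (x / (1 - x) ^ 2) := by
  have hg := hasSum_geometric_of_lt_one h0 h1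
  have := (hg.mul hg (hg.summable.mul_of_nonneg hg.summable (fun i => by positivity)
    (fun i => by positivity))).mul_left x
  have e : (fun p : ℕ × ℕ => x ^ (p.1 + p.2 + 1)) = fun p => x * (x ^ p.1 * x ^ p.2) := by
    funext p; ring
  rw [e, div_eq_mul_inv, sq, mul_inv]
  exact this

noncomputable def L (t : ℝ) (p : ℕ × ℕ) : ℝ := -Real.log (1 - Real.exp (-t) ^ (p.1 + p.2 + 1))

lemma exp_neg_lt {t : ℝ} (ht : 0 < t) : Real.exp (-t) < 1 := by
  rw [Real.exp_lt_one_iff]; linarith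

lemma hasSum_L {t : ℝ} (ht : 0 < t) : HasSum (L t) (phi t) := by
  set q := Real.exp (-t) with hq
  have hq0 : 0 < q := Real.exp_pos _
  have hq1 : q < 1 := exp_neg_lt ht
  let f : ℕ × (ℕ × ℕ) → ℝ := fun z => (q ^ (z.1 + 1)) ^ (z.2.1 + z.2.2 + 1) / ((z.1 : ℝ) + 1)
  have hf0 : 0 ≤ f := fun z => by simp only [f, Pi.zero_apply]; positivity
  have hm : ∀ m : ℕ, HasSum (fun p => f (m, p)) (g (((m : ℝ) + 1) * t) / ((m : ℝ) + 1)) := by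
    intro m
    have := (hasSum_geo2 (x := q ^ (m + 1)) (by positivity)
      (pow_lt_one₀ hq0.le hq1 (by omega))).div_const ((m : ℝ) + 1)
    have e : q ^ (m + 1) = Real.exp (-(((m : ℝ) + 1) * t)) := by
      rw [hq, ← Real.exp_nat_mul]
      push_cast
      ring_nf
    unfold g
    rw [← e]
    exact this
  have hp : ∀ p : ℕ × ℕ, HasSum (fun m => f (m, p)) (L t p) := by
    intro p
    have h1 : q ^ (p.1 + p.2 + 1) < 1 := pow_lt_one₀ hq0.le hq1 (by omega)
    have := Real.hasSum_pow_div_log_of_abs_lt_one (x := q ^ (p.1 + p.2 + 1))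
      (by rw [abs_of_nonneg (by positivity)]; exact h1)
    unfold L
    rw [← hq]
    convert this using 1
    funext m
    simp only [f]
    rw [← pow_mul, ← pow_mul, mul_comm]
  have hs : Summable f := by
    rw [summable_prod_of_nonneg hf0]
    refine ⟨fun m => (hm m).summable, ?_⟩
    refine (summable_phi ht).congr fun m => ?_
    exact (hm m).tsum_eq.symm
  have h1 : HasSum f (phi t) := by
    have := hs.hasSum.prod_fiberwise hm
    unfold phi
    rw [this.tsum_eq]
    exact hs.hasSum
  have h2 := (Equiv.prodComm (ℕ × ℕ) ℕ).hasSum_iff.2 h1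
  exact h2.prod_fiberwise hp

lemma L_nonneg {t : ℝ} (ht : 0 < t) (p : ℕ × ℕ) : 0 ≤ L t p := by
  unfold L
  have h1 : Real.exp (-t) ^ (p.1 + p.2 + 1) < 1 :=
    pow_lt_one₀ (Real.exp_pos _).le (exp_neg_lt ht) (by omega)
  have h0 : 0 < Real.exp (-t) ^ (p.1 + p.2 + 1) := pow_pos (Real.exp_pos _) _
  have := Real.log_nonpos (x := 1 - Real.exp (-t) ^ (p.1 + p.2 + 1)) (by linarith) (by linarith)
  linarith

lemma prod_eq {t : ℝ} (ht : 0 < t) (r : ℕ) :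
    ∏ i ∈ Finset.range r, ∏ j ∈ Finset.range r,
      (1 - ENNReal.ofReal (Real.exp (-t)) ^ (i + j + 1))⁻¹ =
    ENNReal.ofReal (Real.exp (∑ p ∈ Finset.range r ×ˢ Finset.range r, L t p)) := by
  rw [Real.exp_sum, Finset.prod_product, ENNReal.ofReal_prod_of_nonneg
    (fun i _ => Finset.prod_nonneg fun j _ => (Real.exp_pos _).le)]
  refine Finset.prod_congr rfl fun i _ => ?_
  rw [ENNReal.ofReal_prod_of_nonneg (fun j _ => (Real.exp_pos _).le)]
  refine Finset.prod_congr rfl fun j _ => ?_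
  have h1 : Real.exp (-t) ^ (i + j + 1) < 1 :=
    pow_lt_one₀ (Real.exp_pos _).le (exp_neg_lt ht) (by omega)
  have h0 : 0 < Real.exp (-t) ^ (i + j + 1) := pow_pos (Real.exp_pos _) _
  unfold L
  rw [Real.exp_neg (Real.log _), Real.exp_log (by simpa using h1),
    ENNReal.ofReal_inv_of_pos (by simpa using h1), ENNReal.ofReal_sub _ h0.le,
    ENNReal.ofReal_one, ENNReal.ofReal_pow (Real.exp_pos _).le]

abbrev PPs := Σ N : ℕ, {n : ℕ × ℕ → ℕ // IsPlanePartition N n}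

def boxed (r : ℕ) : Set PPs := {x | ∀ i j, (r ≤ i ∨ r ≤ j) → x.2.1 (i, j) = 0}

lemma fin_supp {r : ℕ} {n : ℕ × ℕ → ℕ} (h : ∀ i j, (r ≤ i ∨ r ≤ j) → n (i, j) = 0) :
    (Function.support n).Finite := by
  refine (Finset.range r ×ˢ Finset.range r).finite_toSet.subset ?_
  rintro ⟨i, j⟩ hp
  by_contra hc
  refine hp (h _ _ ?_)
  simp at hc
  by_cases hi : i < r
  · exact .inr (hc hi)
  · exact .inl (by omega)

noncomputable def boxEquiv (r : ℕ) : PPr r ≃ boxed r where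
  toFun n := ⟨⟨∑ᶠ p, n.1 p, n.1, n.2.1, n.2.2.1, fin_supp n.2.2.2, rfl⟩, n.2.2.2⟩
  invFun x := ⟨x.1.2.1, x.1.2.2.1, x.1.2.2.2.1, x.2⟩
  left_inv n := rfl
  right_inv := by
    rintro ⟨⟨N, n, h1, h2, h3, rfl⟩, h⟩
    rfl

lemma boxed_sum {t : ℝ} (ht : 0 < t) (r : ℕ) :
    ∑' x : boxed r, ENNReal.ofReal (Real.exp (-t)) ^ x.1.1 =
    ENNReal.ofReal (Real.exp (∑ p ∈ Finset.range r ×ˢ Finset.range r, L t p)) := by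
  rw [← prod_eq ht, ← macmahon_box, ← (boxEquiv r).tsum_eq]
  rfl

lemma exists_boxed (s : Finset PPs) : ∃ r, ∀ x ∈ s, x ∈ boxed r := by
  classical
  induction s using Finset.induction_on with
  | empty => exact ⟨0, by simp⟩
  | insert x s hx ih =>
    obtain ⟨r, hr⟩ := ih
    have hf := x.2.2.2.2.1
    obtain ⟨M, hM⟩ := (hf.image Prod.fst).bddAbove
    obtain ⟨M', hM'⟩ := (hf.image Prod.snd).bddAbove
    refine ⟨r + M + M' + 1, fun y hy i j hij => ?_⟩
    rcases Finset.mem_insert.1 hy with rfl | hy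
    · by_contra hc
      have h1 := hM (Set.mem_image_of_mem Prod.fst (show (i, j) ∈ Function.support _ from hc))
      have h2 := hM' (Set.mem_image_of_mem Prod.snd (show (i, j) ∈ Function.support _ from hc))
      simp only at h1 h2
      omega
    · exact hr y hy i j (by omega)

open Filter Topology in
lemma macmahon {t : ℝ} (ht : 0 < t) :
    ∑' x : PPs, ENNReal.ofReal (Real.exp (-t)) ^ x.1 = ENNReal.ofReal (Real.exp (phi t)) := by
  apply le_antisymm
  · rw [ENNReal.tsum_eq_iSup_sum]
    refine iSup_le fun s => ?_
    obtain ⟨r, hr⟩ := exists_boxed s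
    calc ∑ x ∈ s, ENNReal.ofReal (Real.exp (-t)) ^ x.1
        = ∑ x ∈ s, (boxed r).indicator (fun x => ENNReal.ofReal (Real.exp (-t)) ^ x.1) x :=
          Finset.sum_congr rfl fun x hx => by rw [Set.indicator_of_mem (hr x hx)]
      _ ≤ ∑' x, (boxed r).indicator (fun x => ENNReal.ofReal (Real.exp (-t)) ^ x.1) x :=
          ENNReal.sum_le_tsum s
      _ = ∑' x : boxed r, ENNReal.ofReal (Real.exp (-t)) ^ x.1.1 := (tsum_subtype _ _).symm
      _ ≤ _ := by
        rw [boxed_sum ht]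
        apply ENNReal.ofReal_le_ofReal
        apply Real.exp_le_exp.2
        exact sum_le_hasSum _ (fun p _ => L_nonneg ht p) (hasSum_L ht)
  · have hl : Tendsto (fun r : ℕ => ENNReal.ofReal (Real.exp
        (∑ p ∈ Finset.range r ×ˢ Finset.range r, L t p))) atTop
        (𝓝 (ENNReal.ofReal (Real.exp (phi t)))) := by
      apply ENNReal.tendsto_ofReal
      apply (Real.continuous_exp.tendsto _).comp
      have : Tendsto (fun r : ℕ => Finset.range r ×ˢ Finset.range r) atTop atTop :=
        by
          refine tendsto_atTop_finset_of_monotone ?_ ?_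
          · intro a b hab
            exact Finset.product_subset_product (Finset.range_mono hab) (Finset.range_mono hab)
          · rintro ⟨i, j⟩
            exact ⟨i + j + 1, by simp only [Finset.mem_product, Finset.mem_range]; omega⟩
      exact (hasSum_L ht).comp this
    refine le_of_tendsto' hl fun r => ?_
    rw [← boxed_sum ht]
    exact ENNReal.tsum_comp_le_tsum_of_injective Subtype.val_injective _

noncomputable def a (N : ℕ) : ℝ := Nat.card {n : ℕ × ℕ → ℕ // IsPlanePartition N n}

lemma macmahon' {t : ℝ} (ht : 0 < t) :
    ∑' N : ℕ, (∑' _ : {n : ℕ × ℕ → ℕ // IsPlanePartition N n},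
      ENNReal.ofReal (Real.exp (-t)) ^ N) = ENNReal.ofReal (Real.exp (phi t)) := by
  rw [← macmahon ht, ENNReal.tsum_sigma']

instance finPP (N : ℕ) : Finite {n : ℕ × ℕ → ℕ // IsPlanePartition N n} := by
  by_contra hc
  rw [not_finite_iff_infinite] at hc
  have h := macmahon' one_pos
  have h2 := ENNReal.le_tsum (f := fun N : ℕ =>
    (∑' _ : {n : ℕ × ℕ → ℕ // IsPlanePartition N n}, ENNReal.ofReal (Real.exp (-1)) ^ N)) N
  rw [h] at h2
  rw [ENNReal.tsum_const_eq_top_of_ne_zero] at h2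
  · simp at h2
  · apply pow_ne_zero
    simp [Real.exp_pos]

lemma hasSum_a {t : ℝ} (ht : 0 < t) :
    HasSum (fun N => a N * Real.exp (-t * N)) (Real.exp (phi t)) := by
  have h := macmahon' ht
  have e : ∀ N : ℕ, (∑' _ : {n : ℕ × ℕ → ℕ // IsPlanePartition N n},
      ENNReal.ofReal (Real.exp (-t)) ^ N) = ENNReal.ofReal (a N * Real.exp (-t * N)) := by
    intro N
    have := Fintype.ofFinite {n : ℕ × ℕ → ℕ // IsPlanePartition N n}
    rw [tsum_fintype, Finset.sum_const, nsmul_eq_mul, Finset.card_univ, a,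
      ENNReal.ofReal_mul (by positivity), ENNReal.ofReal_natCast, Nat.card_eq_fintype_card,
      ← ENNReal.ofReal_pow (Real.exp_pos _).le, ← Real.exp_nat_mul, mul_comm (N : ℝ)]
  simp_rw [e] at h
  have hnn : ∀ N : ℕ, 0 ≤ a N * Real.exp (-t * N) := fun N => by unfold a; positivity
  have hs : Summable fun N : ℕ => a N * Real.exp (-t * N) := by
    have := ENNReal.summable_toReal (f := fun N : ℕ => ENNReal.ofReal (a N * Real.exp (-t * N)))
      (by rw [h]; simp)
    exact this.congr fun N => ENNReal.toReal_ofReal (hnn N)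
  rw [← ENNReal.ofReal_tsum_of_nonneg hnn hs,
    ENNReal.ofReal_eq_ofReal_iff (tsum_nonneg hnn) (Real.exp_pos _).le] at h
  rw [← h]
  exact hs.hasSum

lemma a_mono : Monotone a := by
  refine monotone_nat_of_le_succ fun N => ?_
  unfold a
  norm_cast
  refine Nat.card_le_card_of_injective (fun n => ⟨fun p => n.1 p + if p = (0, 0) then 1 else 0,
    ?_, ?_, ?_, ?_⟩) ?_
  · intro i j
    have := n.2.1 i j
    simp
    omega
  · intro i j
    have := n.2.2.1 i j
    simp
    omega
  · refine (n.2.2.2.1.union (Set.finite_singleton (0, 0))).subset fun p hp => ?_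
    by_contra hc
    simp at hc hp
    tauto
  · rw [finsum_add_distrib n.2.2.2.1, n.2.2.2.2]
    · congr 1
      rw [finsum_eq_single _ (0, 0)]
      · simp
      · intro x hx
        simp [hx]
    · refine (Set.finite_singleton (0, 0)).subset fun p hp => ?_
      by_contra hc
      simp at hc hp
      tauto
  · intro n m h
    apply Subtype.ext
    funext p
    have := congrFun (congrArg Subtype.val h) p
    simpa using this

end PPart

namespace PPart

open Filter Topology

lemma exists_c {δ : ℝ} (h0 : 0 < δ) (h1 : δ < 1) : ∃ ε c : ℝ, 0 < ε ∧ ε < 1 ∧ 0 < c ∧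
    1 / (1 - ε) ^ 2 ≤ 1 - c + 2 * ε * (1 + δ) ∧ 1 / (1 + ε) ^ 2 ≤ 1 - c - 2 * ε * (1 - δ) := by
  set ε := δ / 8 with hε
  have hd : δ = 8 * ε := by rw [hε]; ring
  have e0 : 0 < ε := by positivity
  have e1 : ε < 1 / 8 := by linarith
  have k1 : 1 / (1 - ε) ^ 2 < 1 + 2 * ε * (1 + δ) := by
    rw [div_lt_iff₀ (by nlinarith), hd]
    nlinarith [mul_pos e0 e0, mul_pos (mul_pos e0 e0) e0, mul_pos (mul_pos e0 e0) (mul_pos e0 e0),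
      mul_pos (mul_pos e0 e0) (sub_pos.2 e1)]
  have k2 : 1 / (1 + ε) ^ 2 < 1 - 2 * ε * (1 - δ) := by
    rw [div_lt_iff₀ (by nlinarith), hd]
    nlinarith [mul_pos e0 e0, mul_pos (mul_pos e0 e0) e0, mul_pos (mul_pos e0 e0) (mul_pos e0 e0),
      mul_pos (mul_pos e0 e0) (sub_pos.2 e1)]
  refine ⟨ε, min (1 + 2 * ε * (1 + δ) - 1 / (1 - ε) ^ 2) (1 - 2 * ε * (1 - δ) - 1 / (1 + ε) ^ 2),
    e0, by linarith, lt_min (by linarith) (by linarith), ?_, ?_⟩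
  · have := min_le_left (1 + 2 * ε * (1 + δ) - 1 / (1 - ε) ^ 2)
      (1 - 2 * ε * (1 - δ) - 1 / (1 + ε) ^ 2)
    linarith
  · have := min_le_right (1 + 2 * ε * (1 + δ) - 1 / (1 - ε) ^ 2)
      (1 - 2 * ε * (1 - δ) - 1 / (1 + ε) ^ 2)
    linarith

section Taub

variable {a : ℕ → ℝ} {φ : ℝ → ℝ} {Z : ℝ}

lemma split_bound (ha : Monotone a) (ha0 : ∀ n, 0 ≤ a n)
    (hs : ∀ t, 0 < t → HasSum (fun n : ℕ => a n * Real.exp (-t * n)) (Real.exp (φ t)))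
    {t ε T : ℝ} (ht : 0 < t) (hε : 0 < ε) (hε1 : ε < 1) (N : ℕ) :
    Real.exp (φ t) ≤ Real.exp (-(ε * (t * N))) * Real.exp (φ ((1 - ε) * t)) +
      Real.exp (ε * T) * Real.exp (φ ((1 + ε) * t)) + (N + 1) * (a N * Real.exp (-T)) := by
  have h1 := (hs ((1 - ε) * t) (mul_pos (by linarith) ht)).mul_left (Real.exp (-(ε * (t * N))))
  have h2 := (hs ((1 + ε) * t) (mul_pos (by linarith) ht)).mul_left (Real.exp (ε * T))
  have h3 : HasSum (fun n : ℕ => if n ∈ Finset.range (N + 1) then a N * Real.exp (-T) else 0)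
      ((N + 1) * (a N * Real.exp (-T))) := by
    have := hasSum_sum_of_ne_finset_zero (L := SummationFilter.unconditional ℕ) (s := Finset.range (N + 1))
      (f := fun n : ℕ => if n ∈ Finset.range (N + 1) then a N * Real.exp (-T) else 0)
      (by intro n hn; exact if_neg hn)
    rw [Finset.sum_ite_mem, Finset.inter_self, Finset.sum_const, Finset.card_range,
      nsmul_eq_mul] at this
    exact_mod_cast this
  refine hasSum_le (fun n => ?_) (hs t ht) ((h1.add h2).add h3)
  have p1 : 0 ≤ Real.exp (-(ε * (t * N))) * (a n * Real.exp (-((1 - ε) * t) * n)) :=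
    mul_nonneg (Real.exp_pos _).le (mul_nonneg (ha0 n) (Real.exp_pos _).le)
  have p2 : 0 ≤ Real.exp (ε * T) * (a n * Real.exp (-((1 + ε) * t) * n)) :=
    mul_nonneg (Real.exp_pos _).le (mul_nonneg (ha0 n) (Real.exp_pos _).le)
  have p3 : 0 ≤ if n ∈ Finset.range (N + 1) then a N * Real.exp (-T) else 0 := by
    split_ifs
    · exact mul_nonneg (ha0 N) (Real.exp_pos _).le
    · exact le_rfl
  by_cases c1 : N < n
  · have : a n * Real.exp (-t * n) ≤
        Real.exp (-(ε * (t * N))) * (a n * Real.exp (-((1 - ε) * t) * n)) := by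
      rw [mul_left_comm, ← Real.exp_add]
      apply mul_le_mul_of_nonneg_left _ (ha0 n)
      apply Real.exp_le_exp.2
      have hc : (N : ℝ) ≤ n := by exact_mod_cast c1.le
      have := mul_le_mul_of_nonneg_left hc (mul_pos hε ht).le
      nlinarith
    linarith
  by_cases c2 : t * n < T
  · have : a n * Real.exp (-t * n) ≤
        Real.exp (ε * T) * (a n * Real.exp (-((1 + ε) * t) * n)) := by
      rw [mul_left_comm, ← Real.exp_add]
      apply mul_le_mul_of_nonneg_left _ (ha0 n)
      apply Real.exp_le_exp.2
      have := mul_le_mul_of_nonneg_left c2.le hε.le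
      nlinarith
    linarith
  · have : a n * Real.exp (-t * n) ≤
        if n ∈ Finset.range (N + 1) then a N * Real.exp (-T) else 0 := by
      rw [if_pos (Finset.mem_range.2 (by omega))]
      exact mul_le_mul (ha (by omega)) (Real.exp_le_exp.2 (by linarith)) (Real.exp_pos _).le
        (ha0 N)
    linarith

lemma lower_t (hZ : 0 < Z) (ha : Monotone a) (ha0 : ∀ n, 0 ≤ a n)
    (hs : ∀ t, 0 < t → HasSum (fun n : ℕ => a n * Real.exp (-t * n)) (Real.exp (φ t)))
    (hφ : ∀ t, 0 < t → φ t ≤ Z / t ^ 2)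
    (hl : Tendsto (fun t : ℝ => t ^ 2 * φ t) (𝓝[>] 0) (𝓝 Z)) {δ : ℝ} (h0 : 0 < δ) (h1 : δ < 1) :
    ∀ᶠ t in 𝓝[>] (0 : ℝ), ∀ N : ℕ, 1 ≤ N → t ^ 3 * N = 2 * Z * (1 + δ) →
      t ^ 2 * φ t + 2 * (1 - δ) * Z - t ^ 2 * (Real.log 4 + Real.log N) ≤
        t ^ 2 * Real.log (a N) := by
  obtain ⟨ε, c, e0, e1, c0, k1, k2⟩ := exists_c h0 h1
  have ev1 : ∀ᶠ t in 𝓝[>] (0 : ℝ), (1 - c / 2) * Z < t ^ 2 * φ t :=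
    hl.eventually_const_lt (by nlinarith)
  have ev2 : ∀ᶠ t in 𝓝[>] (0 : ℝ), t ^ 2 * Real.log 4 < c / 2 * Z := by
    have : Tendsto (fun t : ℝ => t ^ 2 * Real.log 4) (𝓝 0) (𝓝 (0 ^ 2 * Real.log 4)) :=
      Continuous.tendsto (by fun_prop) 0
    have := this.mono_left (nhdsWithin_le_nhds (s := Set.Ioi 0))
    exact this.eventually_lt_const (by simp; positivity)
  filter_upwards [ev1, ev2, self_mem_nhdsWithin] with t h3 h4 ht N hN htN
  have ht : 0 < t := ht
  have ht2 : 0 < t ^ 2 := by positivity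
  set w := Z / t ^ 2 with hw
  have hZw : Z = t ^ 2 * w := by rw [hw]; field_simp
  have w0 : 0 < w := by positivity
  have htN' : t * N = 2 * (1 + δ) * w := by
    have : t ^ 2 * (t * N) = t ^ 2 * (2 * (1 + δ) * w) := by
      calc t ^ 2 * (t * N) = t ^ 3 * N := by ring
        _ = _ := by rw [htN, hZw]; ring
    exact mul_left_cancel₀ ht2.ne' this
  have h3' : (1 - c / 2) * w < φ t := by
    rw [hZw] at h3
    have : t ^ 2 * ((1 - c / 2) * w) < t ^ 2 * φ t := by linarith
    exact lt_of_mul_lt_mul_left this ht2.le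
  have h4' : Real.log 4 < c / 2 * w := by
    rw [hZw] at h4
    have : t ^ 2 * Real.log 4 < t ^ 2 * (c / 2 * w) := by linarith
    exact lt_of_mul_lt_mul_left this ht2.le
  have hb := split_bound ha ha0 hs (T := 2 * (1 - δ) * w) ht e0 e1 N
  have b1 : φ ((1 - ε) * t) ≤ (1 - c + 2 * ε * (1 + δ)) * w := by
    calc _ ≤ Z / ((1 - ε) * t) ^ 2 := hφ _ (mul_pos (by linarith) ht)
      _ = 1 / (1 - ε) ^ 2 * w := by rw [hw, mul_pow]; field_simp
      _ ≤ _ := mul_le_mul_of_nonneg_right k1 w0.le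
  have b2 : φ ((1 + ε) * t) ≤ (1 - c - 2 * ε * (1 - δ)) * w := by
    calc _ ≤ Z / ((1 + ε) * t) ^ 2 := hφ _ (mul_pos (by linarith) ht)
      _ = 1 / (1 + ε) ^ 2 * w := by rw [hw, mul_pow]; field_simp
      _ ≤ _ := mul_le_mul_of_nonneg_right k2 w0.le
  have d1 : Real.exp (-(ε * (t * N))) * Real.exp (φ ((1 - ε) * t)) ≤ Real.exp (φ t) / 4 := by
    rw [← Real.exp_add, le_div_iff₀ (by norm_num)]
    nth_rewrite 1 [← Real.exp_log (show (0 : ℝ) < 4 by norm_num)]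
    rw [← Real.exp_add, htN']
    apply Real.exp_le_exp.2
    nlinarith
  have d2 : Real.exp (ε * (2 * (1 - δ) * w)) * Real.exp (φ ((1 + ε) * t)) ≤
      Real.exp (φ t) / 4 := by
    rw [← Real.exp_add, le_div_iff₀ (by norm_num)]
    nth_rewrite 1 [← Real.exp_log (show (0 : ℝ) < 4 by norm_num)]
    rw [← Real.exp_add]
    apply Real.exp_le_exp.2
    nlinarith
  have hN' : (1 : ℝ) ≤ N := by exact_mod_cast hN
  have d3 : Real.exp (φ t) ≤ 4 * N * a N * Real.exp (-(2 * (1 - δ) * w)) := by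
    have : (N + 1) * (a N * Real.exp (-(2 * (1 - δ) * w))) ≤
        2 * N * (a N * Real.exp (-(2 * (1 - δ) * w))) :=
      mul_le_mul_of_nonneg_right (by linarith) (mul_nonneg (ha0 N) (Real.exp_pos _).le)
    nlinarith
  have haN : 0 < a N := by
    rcases (ha0 N).lt_or_eq with h | h
    · exact h
    · rw [← h] at d3
      have := Real.exp_pos (φ t)
      simp at d3
      linarith
  have d4 := Real.log_le_log (Real.exp_pos _) d3
  rw [Real.log_exp, Real.log_mul (by positivity) (Real.exp_pos _).ne', Real.log_exp,
    Real.log_mul (by positivity) haN.ne', Real.log_mul (by norm_num) (by positivity)] at d4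
  have := mul_le_mul_of_nonneg_left d4 ht2.le
  rw [hZw]
  nlinarith

lemma cube_root {s : ℝ} (hs : 0 < s) {N : ℕ} (hN : 1 ≤ N) :
    0 < (s / N) ^ ((1 : ℝ) / 3) ∧ ((s / N) ^ ((1 : ℝ) / 3)) ^ 3 * N = s ∧
    ((s / N) ^ ((1 : ℝ) / 3)) ^ 2 = s ^ ((2 : ℝ) / 3) / (N : ℝ) ^ ((2 : ℝ) / 3) := by
  have hN' : (0 : ℝ) < N := by exact_mod_cast hN
  have h : 0 < s / N := by positivity
  refine ⟨by positivity, ?_, ?_⟩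
  · rw [← Real.rpow_natCast, ← Real.rpow_mul h.le]
    norm_num
    field_simp
  · rw [← Real.rpow_natCast, ← Real.rpow_mul h.le, ← Real.div_rpow hs.le hN'.le]
    norm_num

lemma const_eq (hZ : 0 < Z) :
    3 * (Z / 4) ^ ((1 : ℝ) / 3) = 3 * Z / (2 * Z) ^ ((2 : ℝ) / 3) := by
  have h : (Z / 4) ^ ((1 : ℝ) / 3) * (2 * Z) ^ ((2 : ℝ) / 3) = Z := by
    have e : (2 * Z) ^ ((2 : ℝ) / 3) = ((2 * Z) ^ 2) ^ ((1 : ℝ) / 3) := by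
      rw [← Real.rpow_natCast, ← Real.rpow_mul (by positivity)]
      norm_num
    rw [e, ← Real.mul_rpow (by positivity) (by positivity)]
    have : Z / 4 * (2 * Z) ^ 2 = Z ^ 3 := by ring
    rw [this, ← Real.rpow_natCast, ← Real.rpow_mul hZ.le]
    norm_num
  rw [eq_div_iff (by positivity), mul_assoc, h]

lemma upper (hZ : 0 < Z) (ha0 : ∀ n, 0 ≤ a n)
    (hs : ∀ t, 0 < t → HasSum (fun n : ℕ => a n * Real.exp (-t * n)) (Real.exp (φ t)))
    (hφ : ∀ t, 0 < t → φ t ≤ Z / t ^ 2) {N : ℕ} (hN : 1 ≤ N) :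
    Real.log (a N) / (N : ℝ) ^ ((2 : ℝ) / 3) ≤ 3 * (Z / 4) ^ ((1 : ℝ) / 3) := by
  have hN' : (0 : ℝ) < N := by exact_mod_cast hN
  rcases (ha0 N).lt_or_eq with h | h
  swap
  · rw [← h]; simp; positivity
  obtain ⟨t0, t3, t2⟩ := cube_root (s := 2 * Z) (by positivity) hN
  set t := (2 * Z / N) ^ ((1 : ℝ) / 3)
  rw [const_eq hZ]
  have k : a N * Real.exp (-t * N) ≤ Real.exp (Z / t ^ 2) :=
    (le_hasSum (hs t t0) N fun j _ => mul_nonneg (ha0 j) (Real.exp_pos _).le).trans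
      (Real.exp_le_exp.2 (hφ t t0))
  have k2 := Real.log_le_log (mul_pos h (Real.exp_pos _)) k
  rw [Real.log_exp, Real.log_mul h.ne' (Real.exp_pos _).ne', Real.log_exp] at k2
  have k3 : t * N = 2 * Z / t ^ 2 := by
    rw [← t3]; field_simp
  have k4 : Real.log (a N) ≤ 3 * Z / t ^ 2 := by
    calc _ ≤ Z / t ^ 2 + t * N := by linarith
      _ = _ := by rw [k3]; ring
  calc _ ≤ 3 * Z / t ^ 2 / (N : ℝ) ^ ((2 : ℝ) / 3) := by gcongr
    _ = _ := by rw [t2]; field_simp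

lemma taub (hZ : 0 < Z) (ha : Monotone a) (ha0 : ∀ n, 0 ≤ a n)
    (hs : ∀ t, 0 < t → HasSum (fun n : ℕ => a n * Real.exp (-t * n)) (Real.exp (φ t)))
    (hφ : ∀ t, 0 < t → φ t ≤ Z / t ^ 2)
    (hl : Tendsto (fun t : ℝ => t ^ 2 * φ t) (𝓝[>] 0) (𝓝 Z)) :
    Tendsto (fun N : ℕ => Real.log (a N) / (N : ℝ) ^ ((2 : ℝ) / 3)) atTop
      (𝓝 (3 * (Z / 4) ^ ((1 : ℝ) / 3))) := by
  refine tendsto_order.2 ⟨fun b hb => ?_, fun b hb => ?_⟩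
  swap
  · filter_upwards [eventually_ge_atTop 1] with N hN
    exact (upper hZ ha0 hs hφ hN).trans_lt hb
  have hc : Tendsto (fun δ : ℝ => (Z + 2 * (1 - δ) * Z) / (2 * Z * (1 + δ)) ^ ((2 : ℝ) / 3))
      (𝓝 0) (𝓝 (3 * (Z / 4) ^ ((1 : ℝ) / 3))) := by
    have : ContinuousAt (fun δ : ℝ => (Z + 2 * (1 - δ) * Z) /
        (2 * Z * (1 + δ)) ^ ((2 : ℝ) / 3)) 0 := by
      apply ContinuousAt.div (by fun_prop)
      · apply ContinuousAt.rpow_const (by fun_prop)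
        right; norm_num
      · simp; positivity
    have h := this.tendsto
    simp only [sub_zero, add_zero, mul_one] at h
    rw [const_eq hZ]
    convert h using 3
    ring
  have hc' := hc.mono_left (nhdsWithin_le_nhds (s := Set.Ioi 0))
  obtain ⟨δ, hδ, h1, h0⟩ := ((hc'.eventually_const_lt hb).and
    (((tendsto_id (α := ℝ)).mono_left (nhdsWithin_le_nhds (s := Set.Ioi 0))).eventually_lt_const
      (zero_lt_one (α := ℝ)) |>.and self_mem_nhdsWithin)).exists
  have h0 : 0 < δ := h0
  have h1 : δ < 1 := h1
  set s := 2 * Z * (1 + δ) with hsd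
  have s0 : 0 < s := by positivity
  let τ : ℕ → ℝ := fun N => (s / N) ^ ((1 : ℝ) / 3)
  have hτ : Tendsto τ atTop (𝓝[>] 0) := by
    refine tendsto_nhdsWithin_iff.2 ⟨?_, ?_⟩
    · have := (tendsto_const_div_atTop_nhds_zero_nat s).rpow_const (p := (1 : ℝ) / 3)
        (Or.inr (by norm_num))
      rwa [Real.zero_rpow (by norm_num)] at this
    · filter_upwards [eventually_ge_atTop 1] with N hN
      exact (cube_root s0 hN).1
  have hlog : Tendsto (fun N : ℕ => (τ N) ^ 2 * (Real.log 4 + Real.log N)) atTop (𝓝 0) := by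
    have l1 : Tendsto (fun x : ℝ => Real.log x / x ^ ((2 : ℝ) / 3)) atTop (𝓝 0) :=
      (isLittleO_log_rpow_atTop (by norm_num : (0 : ℝ) < 2 / 3)).tendsto_div_nhds_zero
    have l2 := (l1.comp tendsto_natCast_atTop_atTop).const_mul (s ^ ((2 : ℝ) / 3))
    have l3 : Tendsto (fun N : ℕ => (τ N) ^ 2 * Real.log 4) atTop (𝓝 (0 ^ 2 * Real.log 4)) :=
      ((hτ.mono_right nhdsWithin_le_nhds).pow 2).mul_const _
    have l4 := l3.add l2
    simp only [ne_eq, OfNat.ofNat_ne_zero, not_false_eq_true, zero_pow, zero_mul, mul_zero,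
      add_zero] at l4
    refine l4.congr' ?_
    filter_upwards [eventually_ge_atTop 1] with N hN
    simp only [Function.comp_apply, mul_add]
    congr 1
    rw [(cube_root s0 hN).2.2]
    ring
  have hlow : Tendsto (fun N : ℕ => ((τ N) ^ 2 * φ (τ N) + 2 * (1 - δ) * Z -
      (τ N) ^ 2 * (Real.log 4 + Real.log N)) / s ^ ((2 : ℝ) / 3)) atTop
      (𝓝 ((Z + 2 * (1 - δ) * Z - 0) / s ^ ((2 : ℝ) / 3))) :=
    (((hl.comp hτ).add_const _).sub hlog).div_const _
  rw [sub_zero] at hlow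
  filter_upwards [hlow.eventually_const_lt hδ, hτ.eventually (lower_t hZ ha ha0 hs hφ hl h0 h1),
    eventually_ge_atTop 1] with N n1 n2 hN
  refine n1.trans_le ?_
  obtain ⟨t0, t3, t2⟩ := cube_root s0 hN
  have n3 := n2 N hN t3
  have hN' : (0 : ℝ) < N := by exact_mod_cast hN
  calc _ ≤ (τ N) ^ 2 * Real.log (a N) / s ^ ((2 : ℝ) / 3) := by gcongr
    _ = _ := by
      simp only [τ]
      rw [t2]
      field_simp

end Taub

end PPart

/-- **Asymptotics of the number of plane partitions (Wright, logarithmic form).**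
As `N → ∞`, `log |𝒮_N| / N^{2/3} → 3·(ζ(3)/4)^{1/3}`, where `𝒮_N` is the set of
plane partitions of `N` and `ζ(3) = ∑_{k ≥ 1} 1/k³`. -/
theorem log_card_planePartitions_asymptotic :
    Filter.Tendsto
      (fun N : ℕ =>
        Real.log (Nat.card {n : ℕ × ℕ → ℕ // IsPlanePartition N n}) /
          (N : ℝ) ^ ((2 : ℝ) / 3))
      Filter.atTop
      (nhds (3 * ((∑' k : ℕ, 1 / ((k : ℝ) + 1) ^ 3) / 4) ^ ((1 : ℝ) / 3))) := by
  exact PPart.taub (a := PPart.a) (φ := PPart.phi) (Z := PPart.Zt) PPart.Zt_pos PPart.a_mono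
    (fun n => by unfold PPart.a; positivity) (fun t ht => PPart.hasSum_a ht)
    (fun t ht => PPart.phi_le ht) PPart.phi_lim
end
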